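/- arXiv:1004.1382 — 8 statements merged into one kernel-verified Lean document; each statement's English description precedes it below -/
import Mathlib

section
/- Let h ∈ ℝ[x₁,…,xₙ] be a polynomial that is hyperbolic with respect to e ∈ ℝⁿ and has degree d, and let p(x) = h(x + e) be the associated real zero polynomial. If there exist real symmetric N×N matrices A₁,…,Aₙ (for some N) such that p(x₁,…,xₙ) = det(I + x₁A₁ + ⋯ + xₙAₙ), then there exist real symmetric d×d matrices B₁,…,Bₙ such that p(x₁,…,xₙ) = det(I + x₁B₁ + ⋯ + xₙBₙ). -/
/-- `h(e) ≠ 0` and for every real `x` and complex `μ`, `h(x + μe) = 0` implies `μ` is real.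
(Homogeneity, which is also part of hyperbolicity, is assumed separately.) -/
def IsHyperbolicWrt {n : ℕ} (h : MvPolynomial (Fin n) ℝ) (e : Fin n → ℝ) : Prop :=
  MvPolynomial.eval e h ≠ 0 ∧
    ∀ (x : Fin n → ℝ) (μ : ℂ),
      MvPolynomial.aeval (fun i => (x i : ℂ) + μ * (e i : ℂ)) h = 0 → μ.im = 0

/-- The hyperbolicity cone of `h` at `e`: those `x` for which the univariate polynomial
`t ↦ h(x + te)` has only negative zeros. -/
def hypCone {n : ℕ} (h : MvPolynomial (Fin n) ℝ) (e : Fin n → ℝ) : Set (Fin n → ℝ) :=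
  {x | ∀ μ : ℂ, MvPolynomial.aeval (fun i => (x i : ℂ) + μ * (e i : ℂ)) h = 0 →
    ∃ r : ℝ, μ = (r : ℂ) ∧ r < 0}

/-- A real zero polynomial: for every real `x` and complex `μ`, `p(μx) = 0` implies `μ` real. -/
def IsRealZeroPoly {n : ℕ} (p : MvPolynomial (Fin n) ℝ) : Prop :=
  ∀ (x : Fin n → ℝ) (μ : ℂ),
    MvPolynomial.aeval (fun i => μ * (x i : ℂ)) p = 0 → μ.im = 0

namespace Matrix

variable {ι : Type*} [Fintype ι] [DecidableEq ι]

lemma eval_charpolyRev_eq_det {R : Type*} [CommRing R] (M : Matrix ι ι R) (t : R) :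
    M.charpolyRev.eval t = (1 - t • M).det := by
  rw [charpolyRev, ← Polynomial.coe_evalRingHom, RingHom.map_det]
  congr 1
  ext i j
  obtain rfl | hij := eq_or_ne i j
  · simp [mul_comm t]
  · simp [hij, mul_comm t]

/-- If `det (1 + tK) = det (1 + tL)` for all real `t`, then `K²` and `L²` have the same trace. -/
lemma trace_mul_self_eq_of_det_one_add_smul_eq {K L : Matrix ι ι ℝ}
    (hKL : ∀ t : ℝ, (1 + t • K).det = (1 + t • L).det) :
    (K * K).trace = (L * L).trace := by
  have hsq (P : Matrix ι ι ℝ) (t : ℝ) :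
      (1 - (t * t) • (P * P)).det = (1 + t • P).det * (1 + (-t) • P).det := by
    rw [← det_mul]
    congr 1
    simp only [add_mul, mul_add, one_mul, mul_one, smul_mul_smul_comm, neg_smul, mul_neg]
    abel
  have hrev : (K * K).charpolyRev = (L * L).charpolyRev := by
    refine Polynomial.eq_of_infinite_eval_eq _ _ ((Set.Ici_infinite (0 : ℝ)).mono fun s hs ↦ ?_)
    obtain ⟨t, rfl⟩ : ∃ t : ℝ, s = t * t := ⟨√s, (Real.mul_self_sqrt hs).symm⟩
    simp only [Set.mem_ofPred_eq, eval_charpolyRev_eq_det, hsq, hKL]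
  simpa using congrArg (fun q ↦ q.coeff 1) hrev

lemma IsSymm.trace_mul_self {κ : Type*} [Fintype κ] {M : Matrix κ κ ℝ} (hM : M.IsSymm) :
    (M * M).trace = ∑ i, ∑ j, M i j ^ 2 := by
  simp only [trace, diag_apply, mul_apply]
  refine Finset.sum_congr rfl fun i _ ↦ Finset.sum_congr rfl fun j _ ↦ ?_
  rw [hM.apply i j, sq]

/-- If doubling the rows and columns of `4⁻¹ M` outside `S` does not change
`det (1 + t (4⁻¹ M))`, then `M` is supported on the block `S × S`. -/
lemma IsSymm.apply_eq_zero_of_det_eq {M : Matrix ι ι ℝ} (hM : M.IsSymm) (S : ι → Prop)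
    [DecidablePred S]
    (hdet : ∀ t : ℝ, (1 + t • (diagonal (fun i ↦ if S i then (2⁻¹ : ℝ) else 1) * M *
      diagonal (fun i ↦ if S i then (2⁻¹ : ℝ) else 1))).det = (1 + t • ((4⁻¹ : ℝ) • M)).det)
    {i j : ι} (hij : ¬ (S i ∧ S j)) : M i j = 0 := by
  set c : ι → ℝ := fun i ↦ if S i then 2⁻¹ else 1 with hc
  have hK : (diagonal c * M * diagonal c).IsSymm := by
    ext a b
    simp only [transpose_apply, mul_diagonal, diagonal_mul, hM.apply]
    ring
  have htr := trace_mul_self_eq_of_det_one_add_smul_eq hdet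
  rw [hK.trace_mul_self, (hM.smul (4⁻¹ : ℝ)).trace_mul_self] at htr
  have hle (a b : ι) : ((4⁻¹ : ℝ) • M) a b ^ 2 ≤ (diagonal c * M * diagonal c) a b ^ 2 := by
    simp only [mul_diagonal, diagonal_mul, smul_apply, smul_eq_mul, hc]
    split_ifs <;> nlinarith [sq_nonneg (M a b)]
  have hrow := (Finset.sum_eq_sum_iff_of_le
    fun a _ ↦ Finset.sum_le_sum fun b _ ↦ hle a b).1 htr.symm i (Finset.mem_univ i)
  have hent := (Finset.sum_eq_sum_iff_of_le fun b _ ↦ hle i b).1 hrow j (Finset.mem_univ j)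
  have hsq : M i j ^ 2 = 0 := by
    simp only [mul_diagonal, diagonal_mul, smul_apply, smul_eq_mul, hc] at hent
    split_ifs at hent <;> first | (exact absurd ⟨‹_›, ‹_›⟩ hij) | nlinarith
  exact pow_eq_zero_iff two_ne_zero |>.1 hsq

lemma det_eq_det_submatrix_of_apply_eq_zero {κ R : Type*} [Fintype κ] [DecidableEq κ] [CommRing R]
    {M : Matrix ι ι R} (S : ι → Prop) [DecidablePred S] (f : κ ≃ {i // S i})
    (hM : ∀ i j, ¬ (S i ∧ S j) → M i j = 0) :
    (1 + M).det = (1 + M.submatrix (fun k ↦ (f k : ι)) (fun k ↦ (f k : ι))).det := by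
  rw [twoBlockTriangular_det _ S fun i hi j hj ↦ ?_]
  · have hone : toSquareBlockProp (1 + M) (fun i ↦ ¬ S i) = 1 := by
      ext i j
      simp [toSquareBlockProp_def, hM i j fun h ↦ i.2 h.1, one_apply, Subtype.ext_iff]
    rw [hone, det_one, mul_one, ← det_submatrix_equiv_self f]
    congr 1
    ext i j
    simp [toSquareBlockProp_def, one_apply, ← Subtype.ext_iff]
  · have hne : i ≠ j := fun h ↦ hi (h ▸ hj)
    simp [one_apply_ne hne, hM i j fun h ↦ hi h.1]

lemma IsHermitian.exists_star_mul_mul_eq_diagonal {E : Matrix ι ι ℝ} (hE : E.IsHermitian) :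
    ∃ (U : Matrix ι ι ℝ) (l : ι → ℝ), star U * U = 1 ∧ star U * E * U = diagonal l := by
  refine ⟨hE.eigenvectorUnitary, hE.eigenvalues, Unitary.coe_star_mul_self _, ?_⟩
  simpa [Unitary.conjStarAlgAut_star_apply, Function.comp_def] using
    hE.conjStarAlgAut_star_eigenvectorUnitary

end Matrix

lemma MvPolynomial.IsHomogeneous.eval_smul_eq {σ R : Type*} [CommSemiring R]
    {h : MvPolynomial σ R} {d : ℕ} (hh : h.IsHomogeneous d) (r : R) (x : σ → R) :
    eval (r • x) h = r ^ d * eval x h := by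
  rw [eval_eq, eval_eq, Finset.mul_sum]
  refine Finset.sum_congr rfl fun m hm ↦ ?_
  have hdeg : ∑ i ∈ m.support, m i = d := by
    rw [← hh.degree_eq_sum_deg_support hm]
  simp only [Pi.smul_apply, smul_eq_mul, mul_pow, Finset.prod_mul_distrib, Finset.prod_pow_eq_pow_sum,
    hdeg]
  ring

section Representation

open Matrix

variable {ι σ : Type*} [Fintype ι] [DecidableEq ι] [Fintype σ] {d : ℕ}

/-- If `det (1 + t diag(l)) = (1 + t) ^ d` for all `t`, then `l` takes the value `1` exactly `d`
times and the value `0` otherwise. -/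
lemma eq_zero_or_one_and_card_of_det_one_add_smul_diagonal {l : ι → ℝ}
    (hl : ∀ t : ℝ, (1 + t • diagonal l).det = (1 + t) ^ d) :
    (∀ i, l i ≠ 1 → l i = 0) ∧ Fintype.card {i // l i = 1} = d := by
  have hprod (t : ℝ) : ∏ i, (1 + t * l i) = (1 + t) ^ d := by
    rw [← hl, ← diagonal_one, ← diagonal_smul, diagonal_add, det_diagonal]
    simp
  have h01 (i : ι) (hi : l i ≠ 1) : l i = 0 := by
    by_contra h0
    have hz := hprod (-(l i)⁻¹)
    rw [Finset.prod_eq_zero (Finset.mem_univ i) (by field_simp; ring)] at hz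
    have hz' : 1 + -(l i)⁻¹ = 0 := eq_zero_of_pow_eq_zero hz.symm
    exact hi (inv_eq_one.1 (by linarith))
  refine ⟨h01, ?_⟩
  have h2 := hprod 1
  have hterm (i : ι) : 1 + 1 * l i = if l i = 1 then (2 : ℝ) else 1 := by
    split_ifs with hi
    · rw [hi]; norm_num
    · rw [h01 i hi]; norm_num
  simp only [hterm, Finset.prod_ite, Finset.prod_const] at h2
  rw [Fintype.card_subtype]
  norm_num at h2
  exact h2

/-- A determinantal representation of a homogeneous function of degree `d`, shifted by `e`, is
supported on a `d × d` block when the matrix attached to `e` is diagonal. -/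
lemma exists_submatrix_of_diagonal {F : (σ → ℝ) → ℝ} {e : σ → ℝ}
    (hF : ∀ (r : ℝ) (x : σ → ℝ), F (r • x) = r ^ d * F x)
    {M : σ → Matrix ι ι ℝ} (hM : ∀ k, (M k).IsSymm)
    (hdet : ∀ x : σ → ℝ, F (x + e) = (1 + ∑ k, x k • M k).det)
    {l : ι → ℝ} (hl : ∑ k, e k • M k = diagonal l) :
    ∃ f : Fin d → ι, ∀ x : σ → ℝ,
      F (x + e) = (1 + ∑ k, x k • (M k).submatrix f f).det := by
  have hFe : F e = 1 := by simpa using hdet 0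
  have hadd (s t : ℝ) (x : σ → ℝ) :
      ∑ k, (s • e + t • x) k • M k = s • diagonal l + t • ∑ k, x k • M k := by
    simp [add_smul, Finset.sum_add_distrib, mul_smul, Finset.smul_sum, ← hl]
  obtain ⟨h01, hcard⟩ := eq_zero_or_one_and_card_of_det_one_add_smul_diagonal (d := d) (l := l)
    fun t ↦ by
      have h1 := hdet (t • e + (0 : ℝ) • (0 : σ → ℝ))
      rw [hadd] at h1
      have h2 : t • e + (0 : ℝ) • (0 : σ → ℝ) + e = (1 + t) • e := by
        simp [add_smul, add_comm]
      rw [h2, hF, hFe, mul_one] at h1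
      simpa using h1.symm
  have hsymm (x : σ → ℝ) : (∑ k, x k • M k).IsSymm := by
    simp [IsSymm, transpose_sum, fun k ↦ (hM k).eq]
  have hzero (x : σ → ℝ) (i j : ι) (hij : ¬ (l i = 1 ∧ l j = 1)) :
      (∑ k, x k • M k) i j = 0 := by
    refine (hsymm x).apply_eq_zero_of_det_eq (fun i ↦ l i = 1) (fun t ↦ ?_) hij
    set c : ι → ℝ := fun i ↦ if l i = 1 then 2⁻¹ else 1 with hc
    have hnorm : diagonal c * (1 + (3 : ℝ) • diagonal l) * diagonal c = 1 := by
      rw [← diagonal_one, ← diagonal_smul, diagonal_add, diagonal_mul_diagonal,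
        diagonal_mul_diagonal]
      congr 1
      ext i
      by_cases hi : l i = 1
      · simp [hc, hi]; norm_num
      · simp [hc, h01 i hi]
    have hshift (x : σ → ℝ) :
        (1 + ((3 : ℝ) • diagonal l + t • ∑ k, x k • M k)).det =
          4 ^ d * (1 + t • ((4⁻¹ : ℝ) • ∑ k, x k • M k)).det := by
      have h4 : (3 : ℝ) • e + t • x + e =
          (4 : ℝ) • (((0 : ℝ) • e + (t * 4⁻¹) • x) + e) := by
        ext k
        simp
        ring
      rw [← hadd, ← hdet, h4, hF, hdet, hadd]
      simp [smul_smul]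
    have hsplit : 1 + t • (diagonal c * (∑ k, x k • M k) * diagonal c) =
        diagonal c * (1 + ((3 : ℝ) • diagonal l + t • ∑ k, x k • M k)) * diagonal c := by
      rw [← add_assoc, mul_add, add_mul, hnorm]
      simp
    have hunit : (diagonal c).det * 4 ^ d * (diagonal c).det = 1 := by
      have h0 := hshift 0
      have h1 := congrArg det hnorm
      simp at h0
      simpa [h0] using h1
    rw [hsplit, det_mul, det_mul, hshift]
    linear_combination (1 + t • ((4⁻¹ : ℝ) • ∑ k, x k • M k)).det * hunit
  let f : Fin d ≃ {i // l i = 1} := (Fintype.equivFinOfCardEq hcard).symm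
  refine ⟨fun k ↦ f k, fun x ↦ ?_⟩
  rw [hdet, det_eq_det_submatrix_of_apply_eq_zero (fun i ↦ l i = 1) f (hzero x)]
  congr 2
  ext i j
  simp [Matrix.sum_apply]

end Representation

theorem stmt0 (n d : ℕ) (h : MvPolynomial (Fin n) ℝ) (e : Fin n → ℝ)
    (hhom : h.IsHomogeneous d) (hhyp : IsHyperbolicWrt h e)
    (p : MvPolynomial (Fin n) ℝ)
    (hp : p = MvPolynomial.aeval (fun i => MvPolynomial.X i + MvPolynomial.C (e i)) h)
    (N : ℕ) (A : Fin n → Matrix (Fin N) (Fin N) ℝ) (hsymm : ∀ i, (A i).IsSymm)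
    (hrep : ∀ x : Fin n → ℝ,
      MvPolynomial.eval x p = Matrix.det (1 + ∑ i, x i • A i)) :
    ∃ B : Fin n → Matrix (Fin d) (Fin d) ℝ, (∀ i, (B i).IsSymm) ∧
      ∀ x : Fin n → ℝ, MvPolynomial.eval x p = Matrix.det (1 + ∑ i, x i • B i) := by
  have hF (x : Fin n → ℝ) : MvPolynomial.eval x p = MvPolynomial.eval (x + e) h := by
    rw [hp, ← MvPolynomial.coe_aeval_eq_eval, ← MvPolynomial.coe_aeval_eq_eval]
    simp only [RingHom.coe_coe, ← AlgHom.comp_apply, MvPolynomial.comp_aeval]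
    simp [Pi.add_def]
  have hE : (∑ i, e i • A i).IsHermitian := by
    simp [Matrix.IsHermitian, Matrix.conjTranspose_eq_transpose_of_trivial, Matrix.transpose_sum,
      fun i ↦ (hsymm i).eq]
  obtain ⟨U, l, hU, hl⟩ := hE.exists_star_mul_mul_eq_diagonal
  have hconj (x : Fin n → ℝ) :
      ∑ i, x i • (star U * A i * U) = star U * (∑ i, x i • A i) * U := by
    simp [Finset.mul_sum, Finset.sum_mul]
  have hM (i : Fin n) : (star U * A i * U).IsSymm := by
    simp [Matrix.IsSymm, Matrix.star_eq_conjTranspose, Matrix.mul_assoc, (hsymm i).eq]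
  obtain ⟨f, hf⟩ := exists_submatrix_of_diagonal (F := fun x ↦ MvPolynomial.eval x h) (e := e)
    (fun r x ↦ hhom.eval_smul_eq r x) hM
    (fun x ↦ by
      have hdetU : (star U).det * U.det = 1 := by rw [← Matrix.det_mul, hU, Matrix.det_one]
      have h1 : 1 + star U * (∑ i, x i • A i) * U = star U * (1 + ∑ i, x i • A i) * U := by
        rw [Matrix.mul_add, Matrix.add_mul, Matrix.mul_one, hU]
      rw [← hF, hrep, hconj, h1, Matrix.det_mul, Matrix.det_mul]
      linear_combination -(1 + ∑ i, x i • A i).det * hdetU)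
    ((hconj e).trans hl)
  exact ⟨_, fun i ↦ (hM i).submatrix f, fun x ↦ (hF x).trans (hf x)⟩
end

section
/- Let h ∈ ℝ[x₁,…,xₙ] be a polynomial that is hyperbolic with respect to e ∈ ℝⁿ and has degree d, and let p(x) = h(x + e) be the associated real zero polynomial. If there exist complex Hermitian N×N matrices A₁,…,Aₙ (for some N) such that p(x₁,…,xₙ) = det(I + x₁A₁ + ⋯ + xₙAₙ) for all real x₁,…,xₙ, then there exist complex Hermitian d×d matrices B₁,…,Bₙ such that p(x₁,…,xₙ) = det(I + x₁B₁ + ⋯ + xₙBₙ) for all real x₁,…,xₙ. -/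
theorem MvPolynomial.IsHomogeneous.eval_mul_left {R σ : Type*} [CommSemiring R]
    {φ : MvPolynomial σ R} {d : ℕ} (hφ : φ.IsHomogeneous d) (t : R) (x : σ → R) :
    MvPolynomial.eval (fun i => t * x i) φ = t ^ d * MvPolynomial.eval x φ := by
  rw [MvPolynomial.eval_eq, MvPolynomial.eval_eq, Finset.mul_sum]
  refine Finset.sum_congr rfl fun m hm => ?_
  have hdeg := hφ.degree_eq_sum_deg_support hm
  simp only [mul_pow, Finset.prod_mul_distrib, Finset.prod_pow_eq_pow_sum, hdeg]
  ring

namespace Matrix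

variable {ι R : Type*} [Fintype ι] [DecidableEq ι]

theorem det_diagonal_indicator_add_smul [CommRing R] (s : ι → Prop) [DecidablePred s]
    (M : Matrix ι ι R) (t : R) :
    det (diagonal (fun i => if s i then (0 : R) else 1) + t • M) =
      t ^ Fintype.card {i // s i} *
        det (diagonal (fun i => if s i then (0 : R) else 1) +
          diagonal (fun i => if s i then 1 else t) * M) := by
  have hprod : ∏ i, (if s i then t else 1) = t ^ Fintype.card {i // s i} := by
    rw [Finset.prod_ite, Finset.prod_const, Finset.prod_const_one, mul_one, Fintype.card_subtype]
  rw [← hprod, ← det_diagonal, ← det_mul]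
  congr 1
  ext i j
  rcases eq_or_ne i j with rfl | hij <;> by_cases hi : s i <;> simp [*]

theorem det_diagonal_indicator_add_mul [CommRing R] (s : ι → Prop) [DecidablePred s]
    (M : Matrix ι ι R) :
    det (diagonal (fun i => if s i then (0 : R) else 1) +
      diagonal (fun i => if s i then 1 else 0) * M) = det (M.toSquareBlockProp s) := by
  rw [twoBlockTriangular_det _ s]
  · have h₁ : toSquareBlockProp (diagonal (fun i => if s i then (0 : R) else 1) +
        diagonal (fun i => if s i then 1 else 0) * M) s = M.toSquareBlockProp s := by
      ext ⟨i, hi⟩ ⟨j, hj⟩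
      simp [toSquareBlockProp_def, diagonal_apply, hi]
    have h₂ : toSquareBlockProp (diagonal (fun i => if s i then (0 : R) else 1) +
        diagonal (fun i => if s i then 1 else 0) * M) (fun i => ¬ s i) = 1 := by
      ext ⟨i, hi⟩ ⟨j, hj⟩
      simp [toSquareBlockProp_def, diagonal_apply, one_apply, hi]
    rw [h₁, h₂, det_one, mul_one]
  · intro i hi j hj
    have hij : i ≠ j := by rintro rfl; exact hi hj
    simp [hi, hij]

/-- If `det (P + t • M)`, with `P` the coordinate projection onto the complement of `s`, is
homogeneous in `t` of degree `#s`, then its coefficient is the principal minor of `M` at `s`. -/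
theorem eq_det_toSquareBlockProp_of_homogeneous (s : ι → Prop) [DecidablePred s]
    (M : Matrix ι ι ℂ) (c : ℂ)
    (h : ∀ t : ℝ, det (diagonal (fun i => if s i then (0 : ℂ) else 1) + (t : ℂ) • M) =
      (t : ℂ) ^ Fintype.card {i // s i} * c) :
    c = det (M.toSquareBlockProp s) := by
  let f : ℝ → ℂ := fun t => det (diagonal (fun i => if s i then (0 : ℂ) else 1) +
    diagonal (fun i => if s i then 1 else (t : ℂ)) * M)
  have hf : Continuous f := by
    refine Continuous.matrix_det (continuous_const.add (Continuous.matrix_mul ?_ continuous_const))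
    refine Continuous.matrix_diagonal (continuous_pi fun i => ?_)
    split_ifs <;> fun_prop
  have hfc : ∀ t ∈ ({0}ᶜ : Set ℝ), f t = c := fun t ht => by
    have ht' : (t : ℂ) ^ Fintype.card {i // s i} ≠ 0 := pow_ne_zero _ (by simpa using ht)
    apply mul_left_cancel₀ ht'
    rw [← h t, det_diagonal_indicator_add_smul]
  have hext : f = fun _ => c :=
    Continuous.ext_on (dense_compl_singleton (0 : ℝ)) hf continuous_const hfc
  rw [← congrFun hext 0, ← det_diagonal_indicator_add_mul]
  simp [f]

end Matrix

theorem eq_zero_or_eq_one_of_prod_eq_pow {ι : Type*} [Fintype ι] {a : ι → ℝ} {d : ℕ}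
    (h : ∀ t : ℝ, ∏ i, (1 + t * a i) = (1 + t) ^ d) (i : ι) : a i = 0 ∨ a i = 1 := by
  refine or_iff_not_imp_left.2 fun hi => ?_
  have hz : ∏ j, (1 + -(a i)⁻¹ * a j) = 0 :=
    Finset.prod_eq_zero (Finset.mem_univ i) (by field_simp; ring)
  have h₁ : 1 + -(a i)⁻¹ = 0 := eq_zero_of_pow_eq_zero ((h _).symm.trans hz)
  field_simp at h₁
  linarith

theorem card_eq_one_of_prod_eq_pow {ι : Type*} [Fintype ι] {a : ι → ℝ} {d : ℕ}
    (h : ∀ t : ℝ, ∏ i, (1 + t * a i) = (1 + t) ^ d) : Fintype.card {i // a i = 1} = d := by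
  have h₁ := h 1
  have h₂ : ∀ i, 1 + 1 * a i = if a i = 1 then (2 : ℝ) else 1 := fun i => by
    rcases eq_zero_or_eq_one_of_prod_eq_pow h i with hi | hi <;> norm_num [hi]
  rw [Finset.prod_congr rfl fun i _ => h₂ i, Finset.prod_ite, Finset.prod_const,
    Finset.prod_const_one, mul_one, ← Fintype.card_subtype, one_add_one_eq_two] at h₁
  exact pow_right_injective₀ two_pos (by norm_num) h₁

theorem stmt1 (n d : ℕ) (h : MvPolynomial (Fin n) ℝ) (e : Fin n → ℝ)
    (hhom : h.IsHomogeneous d) (hhyp : IsHyperbolicWrt h e)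
    (p : MvPolynomial (Fin n) ℝ)
    (hp : p = MvPolynomial.aeval (fun i => MvPolynomial.X i + MvPolynomial.C (e i)) h)
    (N : ℕ) (A : Fin n → Matrix (Fin N) (Fin N) ℂ) (hherm : ∀ i, (A i).IsHermitian)
    (hrep : ∀ x : Fin n → ℝ,
      ((MvPolynomial.eval x p : ℝ) : ℂ) = Matrix.det (1 + ∑ i, (x i : ℂ) • A i)) :
    ∃ B : Fin n → Matrix (Fin d) (Fin d) ℂ, (∀ i, (B i).IsHermitian) ∧
      ∀ x : Fin n → ℝ,
        ((MvPolynomial.eval x p : ℝ) : ℂ) = Matrix.det (1 + ∑ i, (x i : ℂ) • B i) := by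
  have hpe (x : Fin n → ℝ) :
      MvPolynomial.eval x p = MvPolynomial.eval (fun i => x i + e i) h := by
    rw [hp, MvPolynomial.aeval_def, MvPolynomial.algebraMap_eq, MvPolynomial.eval_eval₂]
    simp only [map_add, MvPolynomial.eval_X, MvPolynomial.eval_C]
    congr 1
    ext r
    simp
  have he : MvPolynomial.eval e h = 1 := by
    have := hrep 0
    rw [hpe] at this
    simpa using this
  have hHerm : (∑ i, (e i : ℂ) • A i).IsHermitian := by
    simp [Matrix.IsHermitian, Matrix.conjTranspose_sum, Matrix.conjTranspose_smul,
      fun i => (hherm i).eq]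
  let U : Matrix (Fin N) (Fin N) ℂ := hHerm.eigenvectorUnitary.1
  have hUU : U.conjTranspose * U = 1 := Unitary.coe_star_mul_self hHerm.eigenvectorUnitary
  let C (i : Fin n) : Matrix (Fin N) (Fin N) ℂ := U.conjTranspose * A i * U
  have hC (i : Fin n) : (C i).IsHermitian :=
    Matrix.isHermitian_conjTranspose_mul_mul _ (hherm i)
  have hsum (x : Fin n → ℝ) :
      ∑ i, (x i : ℂ) • C i = U.conjTranspose * (∑ i, (x i : ℂ) • A i) * U := by
    simp [C, Matrix.mul_sum, Matrix.sum_mul]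
  have hrepC (x : Fin n → ℝ) :
      ((MvPolynomial.eval x p : ℝ) : ℂ) = Matrix.det (1 + ∑ i, (x i : ℂ) • C i) := by
    have : 1 + ∑ i, (x i : ℂ) • C i = U.conjTranspose * (1 + ∑ i, (x i : ℂ) • A i) * U := by
      rw [hsum, Matrix.mul_add, Matrix.add_mul, Matrix.mul_one, hUU]
    rw [this, Matrix.det_mul_right_comm, hUU, Matrix.one_mul, hrep]
  let a : Fin N → ℝ := hHerm.eigenvalues
  have hdiag : ∑ i, (e i : ℂ) • C i = Matrix.diagonal (fun i => (a i : ℂ)) := by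
    rw [hsum]
    have := hHerm.conjStarAlgAut_star_eigenvectorUnitary
    rw [Unitary.conjStarAlgAut_star_apply] at this
    exact this
  have hprod (t : ℝ) : ∏ i, (1 + t * a i) = (1 + t) ^ d := by
    have h₁ := hrepC (fun i => t * e i)
    have h₂ : (fun i => t * e i + e i) = fun i => (1 + t) * e i := by ext i; ring
    simp only [hpe, h₂, hhom.eval_mul_left, he, mul_one, Complex.ofReal_mul, mul_smul,
      ← Finset.smul_sum, hdiag] at h₁
    rw [← Matrix.diagonal_one, ← Matrix.diagonal_smul, Matrix.diagonal_add,
      Matrix.det_diagonal] at h₁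
    simp only [Pi.smul_apply, smul_eq_mul] at h₁
    exact_mod_cast h₁.symm
  have hcard : Fintype.card {i // a i = 1} = d := card_eq_one_of_prod_eq_pow hprod
  let φ : Fin d ≃ {i // a i = 1} := (Fintype.equivFinOfCardEq hcard).symm
  let B (i : Fin n) : Matrix (Fin d) (Fin d) ℂ :=
    ((C i).toSquareBlockProp (fun j => a j = 1)).submatrix φ φ
  refine ⟨B, fun i => ((hC i).submatrix _).submatrix φ, fun x => ?_⟩
  have hproj : Matrix.diagonal (fun i => if a i = 1 then (0 : ℂ) else 1) =
      1 - ∑ i, (e i : ℂ) • C i := by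
    rw [hdiag, ← Matrix.diagonal_one, Matrix.diagonal_sub]
    congr 1
    ext i
    rcases eq_zero_or_eq_one_of_prod_eq_pow hprod i with hi | hi <;> simp [hi]
  rw [Matrix.eq_det_toSquareBlockProp_of_homogeneous (fun i => a i = 1)
    (∑ i, ((x i + e i : ℝ) : ℂ) • C i) (MvPolynomial.eval x p : ℝ) fun t => ?_,
    ← Matrix.det_submatrix_equiv_self φ]
  · have hone : (∑ i, (e i : ℂ) • C i).submatrix (fun j => (φ j : Fin N)) (fun j => φ j) = 1 := by
      rw [hdiag]
      ext j k
      simp [Matrix.diagonal_apply, Matrix.one_apply, (φ j).2, Subtype.val_inj]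
    congr 1
    rw [← hone]
    ext j k
    simp [B, Matrix.toSquareBlockProp_def, Matrix.sum_apply, add_mul, Finset.sum_add_distrib,
      add_comm]
  · rw [hcard, hproj]
    have h₁ := hrepC (fun i => t * (x i + e i) - e i)
    simp only [hpe, sub_add_cancel, hhom.eval_mul_left] at h₁
    rw [hpe, ← Complex.ofReal_pow, ← Complex.ofReal_mul, h₁]
    congr 1
    simp only [Complex.ofReal_sub, Complex.ofReal_mul, sub_smul, mul_smul,
      Finset.sum_sub_distrib, Finset.smul_sum]
    abel
end

section
/- Let h ∈ ℝ[x₁,…,xₙ] be hyperbolic with respect to 𝟏 = (1,…,1) with hyperbolicity cone containing the open positive orthant ℝ₊ⁿ, and suppose h(x + 𝟏) = det(I + x₁A₁ + ⋯ + xₙAₙ) for Hermitian N×N matrices A₁,…,Aₙ. Then each A_j is positive semidefinite. -/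
open ComplexOrder in
theorem Matrix.IsHermitian.posSemidef_of_det_one_add_smul_ne_zero {N : ℕ}
    {A : Matrix (Fin N) (Fin N) ℂ} (hA : A.IsHermitian)
    (hdet : ∀ t : ℝ, 0 < t → (1 + (t : ℂ) • A).det ≠ 0) : A.PosSemidef := by
  rw [hA.posSemidef_iff_eigenvalues_nonneg]
  intro k
  by_contra hk
  have hk' : hA.eigenvalues k < 0 := not_le.mp hk
  refine hdet (-(hA.eigenvalues k)⁻¹) (neg_pos.mpr (inv_lt_zero.mpr hk')) ?_
  rw [← Matrix.exists_mulVec_eq_zero_iff]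
  refine ⟨hA.eigenvectorBasis k, fun h0 => hA.eigenvectorBasis.toBasis.ne_zero k ?_, ?_⟩
  · ext i
    simpa using congrFun h0 i
  · have hc : (hA.eigenvalues k : ℂ) ≠ 0 := Complex.ofReal_ne_zero.mpr hk'.ne
    ext i
    simp [Matrix.add_mulVec, Matrix.neg_mulVec, Matrix.smul_mulVec, hA.mulVec_eigenvectorBasis, hc]

theorem eval_ne_zero_of_mem_hypCone {n : ℕ} {h : MvPolynomial (Fin n) ℝ} {e x : Fin n → ℝ}
    (hx : x ∈ hypCone h e) : MvPolynomial.eval x h ≠ 0 := by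
  intro h0
  obtain ⟨r, hr, hneg⟩ := hx 0 (by
    have := MvPolynomial.aeval_algebraMap_apply ℂ x h
    simp only [Complex.coe_algebraMap, MvPolynomial.aeval_eq_eval] at this
    simpa [Function.comp_def, h0] using this)
  exact hneg.ne (by exact_mod_cast hr.symm)

open ComplexOrder in
theorem stmt2 (n N : ℕ) (h : MvPolynomial (Fin n) ℝ)
    (hhom : ∃ d, h.IsHomogeneous d)
    (hhyp : IsHyperbolicWrt h (fun _ => 1))
    (hcone : {x : Fin n → ℝ | ∀ i, 0 < x i} ⊆ hypCone h (fun _ => 1))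
    (A : Fin n → Matrix (Fin N) (Fin N) ℂ) (hherm : ∀ i, (A i).IsHermitian)
    (hrep : ∀ x : Fin n → ℝ,
      ((MvPolynomial.eval (fun i => x i + 1) h : ℝ) : ℂ) =
        Matrix.det (1 + ∑ i, (x i : ℂ) • A i)) :
    ∀ j, (A j).PosSemidef := by
  intro j
  refine (hherm j).posSemidef_of_det_one_add_smul_ne_zero fun t ht => ?_
  have hsum : ∑ i, ((Pi.single j t : Fin n → ℝ) i : ℂ) • A i = (t : ℂ) • A j := by
    rw [Finset.sum_eq_single j (fun i _ hij => by simp [hij]) (by simp), Pi.single_eq_same]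
  rw [← hsum, ← hrep, Complex.ofReal_ne_zero]
  refine eval_ne_zero_of_mem_hypCone (hcone fun i => ?_)
  have : 0 ≤ (Pi.single j t : Fin n → ℝ) i :=
    (Pi.single_nonneg.mpr ht.le : (0 : Fin n → ℝ) ≤ Pi.single j t) i
  positivity
end

section
/- Let h ∈ ℝ[x₁,…,xₙ] be hyperbolic with respect to 𝟏 = (1,…,1) of degree d with hyperbolicity cone containing the open positive orthant ℝ₊ⁿ, and suppose h(x + 𝟏) = det(I + x₁A₁ + ⋯ + xₙAₙ) for Hermitian N×N matrices A₁,…,Aₙ. Then the matrix I − (A₁ + ⋯ + Aₙ) is positive semidefinite and has rank N − d. -/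
/-- A homogeneous polynomial of degree `d` scales by `c ^ d` under scaling by `c`. -/
theorem MvPolynomial.IsHomogeneous.eval_smul {σ R : Type*} [CommSemiring R] {p : MvPolynomial σ R}
    {d : ℕ} (hp : p.IsHomogeneous d) (c : R) (x : σ → R) :
    MvPolynomial.eval (c • x) p = c ^ d * MvPolynomial.eval x p := by
  rw [MvPolynomial.eval_eq, MvPolynomial.eval_eq, Finset.mul_sum]
  refine Finset.sum_congr rfl fun m hm => ?_
  have hdeg := hp.degree_eq_sum_deg_support hm
  simp only [Pi.smul_apply, smul_eq_mul, mul_pow, Finset.prod_mul_distrib, Finset.prod_pow_eq_pow_sum]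
  rw [← hdeg]
  ring

section HermitianPencil

variable {ι : Type*} [Fintype ι] [DecidableEq ι] {S : Matrix ι ι ℂ} {d : ℕ}

/-- If `det (1 + t S) = (1 + t) ^ d` for all real `t`, this determines the characteristic
polynomial of `1 - S` away from `1`. -/
theorem eval_charpoly_one_sub_of_det_one_add_smul
    (hdet : ∀ t : ℝ, Matrix.det (1 + (t : ℂ) • S) = (1 + (t : ℂ)) ^ d) {s : ℝ} (hs : s ≠ 1) :
    (1 - S).charpoly.eval (s : ℂ) =
      ((s : ℂ) - 1) ^ Fintype.card ι * ((s : ℂ) / ((s : ℂ) - 1)) ^ d := by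
  have hs' : (s : ℂ) - 1 ≠ 0 := sub_ne_zero.2 (by exact_mod_cast hs)
  have key := hdet (s - 1)⁻¹
  push_cast at key
  have hfac : Matrix.scalar ι (s : ℂ) - (1 - S) =
      ((s : ℂ) - 1) • (1 + ((s : ℂ) - 1)⁻¹ • S) := by
    rw [smul_add, smul_smul, mul_inv_cancel₀ hs', one_smul, sub_smul, one_smul,
      Matrix.scalar_apply, ← Matrix.smul_one_eq_diagonal]
    abel
  rw [Matrix.eval_charpoly, hfac, Matrix.det_smul, key]
  congr 2
  field_simp
  ring

/-- If `S` is Hermitian and `det (1 + t S) = (1 + t) ^ d` for all real `t`, then every eigenvalue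
of `1 - S` is `0` or `1`. -/
theorem eigenvalues_one_sub_eq_zero_or_one
    (hdet : ∀ t : ℝ, Matrix.det (1 + (t : ℂ) • S) = (1 + (t : ℂ)) ^ d)
    (hM : (1 - S).IsHermitian) (i : ι) : hM.eigenvalues i = 0 ∨ hM.eigenvalues i = 1 := by
  refine or_iff_not_imp_right.2 fun hne => ?_
  have hs' : (hM.eigenvalues i : ℂ) - 1 ≠ 0 := sub_ne_zero.2 (by exact_mod_cast hne)
  have hev := eval_charpoly_one_sub_of_det_one_add_smul hdet hne
  have hroot : (1 - S).charpoly.eval (hM.eigenvalues i : ℂ) = 0 := by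
    rw [hM.charpoly_eq, Polynomial.eval_prod]
    exact Finset.prod_eq_zero (Finset.mem_univ i) (by simp)
  rw [hroot] at hev
  have hz := (mul_eq_zero.1 hev.symm).resolve_left (pow_ne_zero _ hs')
  have hz' := (div_eq_zero_iff.1 (eq_zero_of_pow_eq_zero hz)).resolve_right hs'
  exact_mod_cast hz'

/-- If `S` is Hermitian and `det (1 + t S) = (1 + t) ^ d` for all real `t`, then `1 - S` has
exactly `d` zero eigenvalues. -/
theorem card_eigenvalues_one_sub_eq_zero
    (hdet : ∀ t : ℝ, Matrix.det (1 + (t : ℂ) • S) = (1 + (t : ℂ)) ^ d)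
    (hM : (1 - S).IsHermitian) : Fintype.card {i // hM.eigenvalues i = 0} = d := by
  have hev := eval_charpoly_one_sub_of_det_one_add_smul hdet (s := 2) (by norm_num)
  rw [hM.charpoly_eq, Polynomial.eval_prod] at hev
  have hprod : ∀ i, (Polynomial.X - Polynomial.C (hM.eigenvalues i : ℂ)).eval ((2 : ℝ) : ℂ) =
      if hM.eigenvalues i = 0 then 2 else 1 := by
    intro i
    rcases eigenvalues_one_sub_eq_zero_or_one hdet hM i with hi | hi <;> norm_num [hi]
  have hpow : (2 : ℂ) ^ Fintype.card {i // hM.eigenvalues i = 0} = 2 ^ d := by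
    have hr : (((2 : ℝ) : ℂ) - 1) = 1 := by norm_num
    rw [hr, one_pow, one_mul, div_one] at hev
    refine Eq.trans ?_ (hev.trans (by norm_num))
    rw [Fintype.card_subtype, ← Finset.prod_const, Finset.prod_filter]
    exact Finset.prod_congr rfl fun i _ => (hprod i).symm
  exact Nat.pow_right_injective le_rfl (by exact_mod_cast hpow)

/-- If `S` is Hermitian and `det (1 + t S) = (1 + t) ^ d` for all real `t`, then `1 - S` has
corank `d`. -/
theorem rank_one_sub_of_det_one_add_smul
    (hdet : ∀ t : ℝ, Matrix.det (1 + (t : ℂ) • S) = (1 + (t : ℂ)) ^ d)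
    (hM : (1 - S).IsHermitian) : (1 - S).rank = Fintype.card ι - d := by
  rw [hM.rank_eq_card_non_zero_eigs, Fintype.card_subtype_compl,
    card_eigenvalues_one_sub_eq_zero hdet hM]

open ComplexOrder in
/-- If `S` is Hermitian and `det (1 + t S) = (1 + t) ^ d` for all real `t`, then `1 - S` is
positive semidefinite. -/
theorem posSemidef_one_sub_of_det_one_add_smul
    (hdet : ∀ t : ℝ, Matrix.det (1 + (t : ℂ) • S) = (1 + (t : ℂ)) ^ d)
    (hM : (1 - S).IsHermitian) : (1 - S).PosSemidef := by
  refine hM.posSemidef_iff_eigenvalues_nonneg.2 fun i => ?_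
  rcases eigenvalues_one_sub_eq_zero_or_one hdet hM i with hi | hi <;> simp [hi]

end HermitianPencil

open ComplexOrder in
theorem stmt3 (n N d : ℕ) (h : MvPolynomial (Fin n) ℝ)
    (hhom : h.IsHomogeneous d)
    (hhyp : IsHyperbolicWrt h (fun _ => 1))
    (hcone : {x : Fin n → ℝ | ∀ i, 0 < x i} ⊆ hypCone h (fun _ => 1))
    (A : Fin n → Matrix (Fin N) (Fin N) ℂ) (hherm : ∀ i, (A i).IsHermitian)
    (hrep : ∀ x : Fin n → ℝ,
      ((MvPolynomial.eval (fun i => x i + 1) h : ℝ) : ℂ) =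
        Matrix.det (1 + ∑ i, (x i : ℂ) • A i)) :
    ((1 : Matrix (Fin N) (Fin N) ℂ) - ∑ i, A i).PosSemidef ∧
      ((1 : Matrix (Fin N) (Fin N) ℂ) - ∑ i, A i).rank = N - d := by
  have hone : MvPolynomial.eval (fun _ => (1 : ℝ)) h = 1 := by
    have h0 := hrep 0
    simp only [Pi.zero_apply, zero_add, Complex.ofReal_zero, zero_smul, Finset.sum_const_zero,
      add_zero, Matrix.det_one] at h0
    exact_mod_cast h0
  have hdet : ∀ t : ℝ, Matrix.det (1 + (t : ℂ) • ∑ i, A i) = (1 + (t : ℂ)) ^ d := by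
    intro t
    have hscale := hhom.eval_smul (1 + t) (fun _ => 1)
    have harg : (1 + t) • (fun _ : Fin n => (1 : ℝ)) = fun _ => t + 1 := by
      ext i
      simp [add_comm]
    rw [hone, mul_one, harg] at hscale
    have ht := hrep fun _ => t
    rw [hscale, ← Finset.smul_sum] at ht
    rw [← ht]
    push_cast
    rfl
  have hM : ((1 : Matrix (Fin N) (Fin N) ℂ) - ∑ i, A i).IsHermitian := by
    refine Matrix.isHermitian_one.sub ?_
    rw [Matrix.IsHermitian, Matrix.conjTranspose_sum]
    exact Finset.sum_congr rfl fun i _ => hherm i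
  exact ⟨posSemidef_one_sub_of_det_one_add_smul hdet hM, by
    simpa using rank_one_sub_of_det_one_add_smul hdet hM⟩
end

section
/- (Ingleton inequalities) Let 𝒱 = (V₁,…,Vₙ) be a collection of subspaces of a finite dimensional vector space over a field K, and let r_𝒱(S) = dim(Σ_{i∈S} V_i). Then for all S₁, S₂, S₃, S₄ ⊆ {1,…,n}: r_𝒱(S₁∪S₂) + r_𝒱(S₁∪S₃∪S₄) + r_𝒱(S₃) + r_𝒱(S₄) + r_𝒱(S₂∪S₃∪S₄) ≤ r_𝒱(S₁∪S₃) + r_𝒱(S₁∪S₄) + r_𝒱(S₂∪S₃) + r_𝒱(S₂∪S₄) + r_𝒱(S₃∪S₄). -/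
namespace Submodule

variable {K V : Type*} [Field K] [AddCommGroup V] [Module K V] [FiniteDimensional K V]

/-- Submodularity of dimension, with the sum and the intersection replaced by smaller subspaces. -/
theorem finrank_add_finrank_le_of_le_sup_of_le_inf {S I A B : Submodule K V}
    (hS : S ≤ A ⊔ B) (hI : I ≤ A ⊓ B) :
    Module.finrank K S + Module.finrank K I ≤ Module.finrank K A + Module.finrank K B := by
  rw [← finrank_sup_add_finrank_inf_eq A B]
  exact add_le_add (finrank_mono hS) (finrank_mono hI)

/-- Ingleton's inequality for four subspaces. -/
theorem ingleton_inequality (A B C D : Submodule K V) :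
    Module.finrank K ↥(A ⊔ B) + Module.finrank K ↥(A ⊔ C ⊔ D) + Module.finrank K C +
        Module.finrank K D + Module.finrank K ↥(B ⊔ C ⊔ D) ≤
      Module.finrank K ↥(A ⊔ C) + Module.finrank K ↥(A ⊔ D) + Module.finrank K ↥(B ⊔ C) +
        Module.finrank K ↥(B ⊔ D) + Module.finrank K ↥(C ⊔ D) := by
  have key (X : Submodule K V) :
      Module.finrank K ↥(X ⊔ C ⊔ D) + Module.finrank K ↥(X ⊔ C ⊓ D) ≤
        Module.finrank K ↥(X ⊔ C) + Module.finrank K ↥(X ⊔ D) :=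
    finrank_add_finrank_le_of_le_sup_of_le_inf
      (sup_le le_sup_left (le_sup_right.trans le_sup_right))
      (le_inf (sup_le_sup_left inf_le_left X) (sup_le_sup_left inf_le_right X))
  have hAB : Module.finrank K ↥(A ⊔ B) + Module.finrank K ↥(C ⊓ D) ≤
      Module.finrank K ↥(A ⊔ C ⊓ D) + Module.finrank K ↥(B ⊔ C ⊓ D) :=
    finrank_add_finrank_le_of_le_sup_of_le_inf
      (sup_le_sup le_sup_left le_sup_left) (le_inf le_sup_right le_sup_right)
  have hCD := finrank_sup_add_finrank_inf_eq C D
  linarith [key A, key B]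

end Submodule

theorem stmt8 (K : Type*) [Field K] (V : Type*) [AddCommGroup V] [Module K V]
    [FiniteDimensional K V] (n : ℕ) (𝒱 : Fin n → Submodule K V)
    (S₁ S₂ S₃ S₄ : Finset (Fin n)) :
    let r : Finset (Fin n) → ℕ := fun S => Module.finrank K ↥(⨆ i ∈ S, 𝒱 i)
    r (S₁ ∪ S₂) + r (S₁ ∪ S₃ ∪ S₄) + r S₃ + r S₄ + r (S₂ ∪ S₃ ∪ S₄) ≤
      r (S₁ ∪ S₃) + r (S₁ ∪ S₄) + r (S₂ ∪ S₃) + r (S₂ ∪ S₄) + r (S₃ ∪ S₄) := by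
  intro r
  let W : Finset (Fin n) → Submodule K V := fun S => ⨆ i ∈ S, 𝒱 i
  have hW (S T : Finset (Fin n)) : W (S ∪ T) = W S ⊔ W T := Finset.iSup_union
  have h := Submodule.ingleton_inequality (W S₁) (W S₂) (W S₃) (W S₄)
  rwa [← hW, ← hW, ← hW, ← hW, ← hW, ← hW, ← hW, ← hW] at h
end

section
/- Let h ∈ ℝ[x₁,…,x_m] be a homogeneous polynomial that is hyperbolic with respect to e ∈ ℝ^m, and let ℰ = (e₁,…,eₙ) be a tuple of n vectors lying in the closure of the hyperbolicity cone of h containing e. Then the function r_ℰ : 2^{[n]} → ℕ defined by r_ℰ(S) = deg_t h(e + t·Σ_{i∈S} e_i) is a polymatroid, i.e., r_ℰ(∅) = 0, r_ℰ is monotone, and r_ℰ is submodular. -/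
open scoped Topology

open MvPolynomial in
theorem aeval_smul_of_isHomogeneous {σ K : Type*} [CommRing K] [Algebra ℝ K]
    {h : MvPolynomial σ ℝ} {d : ℕ} (hh : h.IsHomogeneous d) (c : K) (z : σ → K) :
    aeval (c • z) h = c ^ d * aeval z h := by
  rw [aeval_def, aeval_def, eval₂_eq, eval₂_eq, Finset.mul_sum]
  refine Finset.sum_congr rfl fun s hs => ?_
  have hd : ∑ i ∈ s.support, s i = d := by
    rw [← hh (mem_support_iff.mp hs), Finsupp.weight_apply, Finsupp.sum]
    simp
  simp only [Pi.smul_apply, smul_eq_mul, mul_pow, Finset.prod_mul_distrib, Finset.prod_pow_eq_pow_sum,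
    hd]
  ring

/-- The restriction of `h` to the affine line `t ↦ z + t w`. -/
noncomputable def linePoly {m : ℕ} {K : Type*} [Field K] [Algebra ℝ K]
    (h : MvPolynomial (Fin m) ℝ) (z w : Fin m → K) : Polynomial K :=
  MvPolynomial.aeval (fun j => Polynomial.C (z j) + Polynomial.X * Polynomial.C (w j)) h

theorem eval_linePoly {m : ℕ} {K : Type*} [Field K] [Algebra ℝ K]
    (h : MvPolynomial (Fin m) ℝ) (z w : Fin m → K) (t : K) :
    (linePoly h z w).eval t = MvPolynomial.aeval (z + t • w) h := by
  have := MvPolynomial.map_aeval (fun j => Polynomial.C (z j) + Polynomial.X * Polynomial.C (w j))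
    (Polynomial.evalRingHom t) h
  rw [linePoly, ← Polynomial.coe_evalRingHom, this, MvPolynomial.aeval_def]
  have h1 : (Polynomial.evalRingHom t).comp (algebraMap ℝ (Polynomial K)) = algebraMap ℝ K := by
    ext r
    simp [Polynomial.algebraMap_apply]
  rw [h1, MvPolynomial.coe_eval₂Hom]
  congr 1
  ext j
  simp [mul_comm t]

theorem linePoly_natDegree_coeff {m : ℕ} {K : Type*} [Field K] [Algebra ℝ K]
    {h : MvPolynomial (Fin m) ℝ} {d : ℕ} (hh : h.IsHomogeneous d) (z w : Fin m → K) :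
    (linePoly h z w).natDegree ≤ d ∧ (linePoly h z w).coeff d = MvPolynomial.aeval w h := by
  have key : ∀ (s : Fin m →₀ ℕ) (u : Finset (Fin m)),
      (∏ i ∈ u, (Polynomial.C (z i) + Polynomial.X * Polynomial.C (w i)) ^ s i).natDegree
        ≤ ∑ i ∈ u, s i ∧
      (∏ i ∈ u, (Polynomial.C (z i) + Polynomial.X * Polynomial.C (w i)) ^ s i).coeff
        (∑ i ∈ u, s i) = ∏ i ∈ u, w i ^ s i := by
    intro s u
    have h1 : ∀ i, (Polynomial.C (z i) + Polynomial.X * Polynomial.C (w i)).natDegree ≤ 1 := by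
      intro i
      compute_degree
    have h2 : ∀ i, ((Polynomial.C (z i) + Polynomial.X * Polynomial.C (w i)) ^ s i).natDegree
        ≤ s i := fun i => by simpa using Polynomial.natDegree_pow_le_of_le (s i) (h1 i)
    induction u using Finset.induction_on with
    | empty => simp
    | insert a u ha ih =>
      simp only [Finset.prod_insert ha, Finset.sum_insert ha]
      refine ⟨Polynomial.natDegree_mul_le_of_le (h2 a) ih.1, ?_⟩
      rw [Polynomial.coeff_mul_add_eq_of_natDegree_le (h2 a) ih.1, ih.2]
      congr 1
      have := Polynomial.coeff_pow_of_natDegree_le (m := s a) (h1 a)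
      rw [mul_one] at this
      rw [this]
      simp [Polynomial.coeff_C]
  have hd : ∀ s ∈ h.support, ∑ i ∈ s.support, s i = d := by
    intro s hs
    rw [← hh (MvPolynomial.mem_support_iff.mp hs), Finsupp.weight_apply, Finsupp.sum]
    simp
  rw [linePoly, MvPolynomial.aeval_def, MvPolynomial.aeval_def, MvPolynomial.eval₂_eq,
    MvPolynomial.eval₂_eq]
  constructor
  · refine Polynomial.natDegree_sum_le_of_forall_le _ _ fun s hs => ?_
    rw [Polynomial.algebraMap_apply]
    exact (Polynomial.natDegree_C_mul_le _ _).trans ((key s s.support).1.trans (hd s hs).le)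
  · rw [Polynomial.finsetSum_coeff]
    refine Finset.sum_congr rfl fun s hs => ?_
    rw [Polynomial.algebraMap_apply, Polynomial.coeff_C_mul]
    congr 1
    rw [← (key s s.support).2, hd s hs]

theorem Polynomial.norm_coeff_mul_pow_le_norm_eval {P : Polynomial ℂ} {d : ℕ}
    (hP : P.natDegree ≤ d) {δ : ℝ} (hδ : 0 ≤ δ) {t : ℂ}
    (hroots : ∀ ζ, P.eval ζ = 0 → δ ≤ ‖t - ζ‖) : ‖P.coeff d‖ * δ ^ d ≤ ‖P.eval t‖ := by
  by_cases hc : P.coeff d = 0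
  · simp [hc]
  have hd : P.natDegree = d := le_antisymm hP (Polynomial.le_natDegree_of_ne_zero hc)
  have hs := IsAlgClosed.splits P
  have hP0 : P ≠ 0 := by
    rintro rfl
    simp at hc
  rw [hs.eval_eq_prod_roots t, norm_mul, ← hd, Polynomial.coeff_natDegree]
  gcongr
  rw [hs.natDegree_eq_card_roots]
  have : ∀ s : Multiset ℂ, (∀ ζ ∈ s, δ ≤ ‖t - ζ‖) →
      δ ^ s.card ≤ ‖(s.map fun ζ => t - ζ).prod‖ := by
    intro s
    induction s using Multiset.induction_on with
    | empty => simp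
    | cons a s ih =>
      intro hs
      simp only [Multiset.card_cons, Multiset.map_cons, Multiset.prod_cons, norm_mul]
      rw [pow_succ']
      gcongr
      · exact hs a (Multiset.mem_cons_self a s)
      · exact ih fun ζ hζ => hs ζ (Multiset.mem_cons_of_mem hζ)
  exact this _ fun ζ hζ => hroots ζ ((Polynomial.mem_roots hP0).mp hζ)

theorem norm_aeval_mul_pow_le {m : ℕ} {h : MvPolynomial (Fin m) ℝ} {d : ℕ}
    (hh : h.IsHomogeneous d) (z w : Fin m → ℂ) (t : ℂ) {δ : ℝ} (hδ : 0 ≤ δ)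
    (hroots : ∀ ζ : ℂ, MvPolynomial.aeval (z + ζ • w) h = 0 → δ ≤ ‖t - ζ‖) :
    ‖MvPolynomial.aeval w h‖ * δ ^ d ≤ ‖MvPolynomial.aeval (z + t • w) h‖ := by
  have := linePoly_natDegree_coeff hh z w
  rw [← this.2, ← eval_linePoly]
  exact Polynomial.norm_coeff_mul_pow_le_norm_eval this.1 hδ fun ζ hζ =>
    hroots ζ (by rwa [← eval_linePoly])

theorem continuous_aeval_vec {m : ℕ} (h : MvPolynomial (Fin m) ℝ) :
    Continuous fun z : Fin m → ℂ => MvPolynomial.aeval z h := by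
  simp only [MvPolynomial.aeval_def, MvPolynomial.eval₂_eq]
  fun_prop

/-- A real vector, viewed as a complex vector. -/
noncomputable def toComplexVec {m : ℕ} (y : Fin m → ℝ) : Fin m → ℂ := fun j => (y j : ℂ)

/-- `h` has no zero whose imaginary part is `y`. -/
def NonvanishingDirection {m : ℕ} (h : MvPolynomial (Fin m) ℝ) (y : Fin m → ℝ) : Prop :=
  ∀ x : Fin m → ℝ,
    MvPolynomial.aeval (toComplexVec x + Complex.I • toComplexVec y) h ≠ 0

section

variable {m d : ℕ} {h : MvPolynomial (Fin m) ℝ} {e : Fin m → ℝ}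

theorem continuous_toComplexVec : Continuous (toComplexVec (m := m)) := by
  unfold toComplexVec
  fun_prop

theorem aeval_toComplexVec (h : MvPolynomial (Fin m) ℝ) (y : Fin m → ℝ) :
    MvPolynomial.aeval (toComplexVec y) h = ((MvPolynomial.aeval y h : ℝ) : ℂ) :=
  MvPolynomial.aeval_algebraMap_apply ℂ y h

theorem NonvanishingDirection.aeval_ne_zero {y : Fin m → ℝ} (hh : h.IsHomogeneous d)
    (hy : NonvanishingDirection h y) (x : Fin m → ℝ) {z : ℂ} (hz : z.im ≠ 0) :
    MvPolynomial.aeval (toComplexVec x + z • toComplexVec y) h ≠ 0 := by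
  have hz' : (z.im : ℂ) ≠ 0 := by exact_mod_cast hz
  have : toComplexVec x + z • toComplexVec y =
      (z.im : ℂ) • (toComplexVec (z.im⁻¹ • (x + z.re • y)) + Complex.I • toComplexVec y) := by
    ext j
    simp only [toComplexVec, Pi.add_apply, Pi.smul_apply, smul_eq_mul]
    push_cast
    field_simp
    conv_lhs => rw [← Complex.re_add_im z]
    ring
  rw [this, aeval_smul_of_isHomogeneous hh]
  exact mul_ne_zero (pow_ne_zero _ hz') (hy _)

theorem NonvanishingDirection.aeval_self_ne_zero {y : Fin m → ℝ} (hh : h.IsHomogeneous d)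
    (hy : NonvanishingDirection h y) : MvPolynomial.aeval (toComplexVec y) h ≠ 0 := by
  have := hy 0
  rw [show toComplexVec (0 : Fin m → ℝ) = 0 by ext; simp [toComplexVec], zero_add,
    aeval_smul_of_isHomogeneous hh] at this
  exact right_ne_zero_of_mul this

theorem IsHyperbolicWrt.nonvanishingDirection (hhyp : IsHyperbolicWrt h e) :
    NonvanishingDirection h e := by
  intro x hx
  simpa using hhyp.2 x Complex.I hx

theorem aeval_ne_zero_of_mem_hypCone {k : Fin m → ℝ} (hk : k ∈ hypCone h e) :
    MvPolynomial.aeval (toComplexVec k) h ≠ 0 := by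
  intro h0
  obtain ⟨r, hr, hr0⟩ := hk 0 (by simp only [zero_mul, add_zero]; exact h0)
  have : r = 0 := by exact_mod_cast hr.symm
  exact hr0.ne this

theorem aeval_I_smul_add_smul_ne_zero (hh : h.IsHomogeneous d) (hhyp : IsHyperbolicWrt h e)
    {k : Fin m → ℝ} (hk : k ∈ hypCone h e) {t : ℂ} (ht : 0 ≤ t.im) :
    MvPolynomial.aeval (Complex.I • toComplexVec e + t • toComplexVec k) h ≠ 0 := by
  by_cases ht0 : t = 0
  · rw [ht0, zero_smul, add_zero, aeval_smul_of_isHomogeneous hh]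
    exact mul_ne_zero (pow_ne_zero _ Complex.I_ne_zero)
      (hhyp.nonvanishingDirection.aeval_self_ne_zero hh)
  have : Complex.I • toComplexVec e + t • toComplexVec k =
      t • fun j => ((k j : ℂ) + Complex.I / t * (e j : ℂ)) := by
    ext j
    simp only [toComplexVec, Pi.add_apply, Pi.smul_apply, smul_eq_mul]
    field_simp
    ring
  rw [this, aeval_smul_of_isHomogeneous hh]
  refine mul_ne_zero (pow_ne_zero _ ht0) fun h0 => ?_
  obtain ⟨r, hr, hr0⟩ := hk _ h0
  have h1 : Complex.I = r * t := by
    rw [← hr]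
    field_simp
  have h2 := congrArg Complex.im h1
  simp at h2
  nlinarith

theorem aeval_ne_zero_of_mem_hypCone_of_path (hh : h.IsHomogeneous d)
    (hhyp : IsHyperbolicWrt h e) {k₁ k : Fin m → ℝ}
    (hk₁ : ∀ s : ℝ, 0 ≤ s → NonvanishingDirection h (e + s • k₁)) (hk : k ∈ hypCone h e)
    (x : Fin m → ℝ) {t : ℂ} (ht : 0 ≤ t.im) :
    MvPolynomial.aeval
      (toComplexVec x + Complex.I • toComplexVec (e + k₁) + t • toComplexVec k) h ≠ 0 := by
  set γ : ℝ → Fin m → ℂ := fun τ =>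
    toComplexVec (τ • x) + Complex.I • toComplexVec (e + τ ^ 2 • k₁) with hγ
  have hγc : Continuous γ := by
    have := continuous_toComplexVec (m := m)
    fun_prop
  set P : ℝ → ℂ → ℂ := fun τ t => MvPolynomial.aeval (γ τ + t • toComplexVec k) h with hP
  have hPc : Continuous fun q : ℝ × ℂ => P q.1 q.2 :=
    (continuous_aeval_vec h).comp (by fun_prop)
  have hPreal : ∀ (τ : ℝ) (t : ℂ), t.im = 0 → P τ t ≠ 0 := by
    intro τ t ht
    have := hk₁ (τ ^ 2) (sq_nonneg τ) (τ • x + t.re • k)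
    convert this using 3
    ext j
    have ht' : t = t.re := by
      apply Complex.ext <;> simp [ht]
    conv_lhs => rw [ht']
    simp only [hγ, toComplexVec, Pi.add_apply, Pi.smul_apply, smul_eq_mul]
    push_cast
    ring
  have hk0 := aeval_ne_zero_of_mem_hypCone hk
  set B : Set ℝ := {τ | ∀ t : ℂ, 0 ≤ t.im → P τ t ≠ 0} with hB
  have hB0 : (0 : ℝ) ∈ B := by
    intro t ht
    have := aeval_I_smul_add_smul_ne_zero hh hhyp hk ht
    convert this using 3
    ext j
    simp [hγ, toComplexVec]
  have hBclosed : IsClosed B := by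
    rw [← isOpen_compl_iff, isOpen_iff_mem_nhds]
    intro τ₀ hτ₀
    simp only [hB, Set.mem_compl_iff, Set.mem_ofPred_eq, not_forall, not_not] at hτ₀
    obtain ⟨t₀, ht₀, h0⟩ := hτ₀
    have hpos : 0 < t₀.im := lt_of_le_of_ne ht₀ fun hne => hPreal τ₀ t₀ hne.symm h0
    have hbd : 0 < ‖MvPolynomial.aeval (toComplexVec k) h‖ * t₀.im ^ d := by positivity
    have hcont : Continuous fun τ => ‖P τ t₀‖ :=
      (hPc.comp (Continuous.prodMk_left t₀)).norm
    have hev : ∀ᶠ τ in 𝓝 τ₀, ‖P τ t₀‖ < ‖MvPolynomial.aeval (toComplexVec k) h‖ * t₀.im ^ d :=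
      hcont.continuousAt.eventually_lt continuousAt_const (by simpa [h0] using hbd)
    filter_upwards [hev] with τ hτ hτB
    refine hτ.not_ge (norm_aeval_mul_pow_le hh _ _ _ hpos.le fun ζ hζ => ?_)
    have hζ' : ζ.im < 0 := by
      by_contra hcon
      exact hτB ζ (not_lt.mp hcon) hζ
    have := Complex.abs_im_le_norm (t₀ - ζ)
    rw [Complex.sub_im] at this
    linarith [le_abs_self (t₀.im - ζ.im)]
  have hBopen : IsOpen B := by
    rw [isOpen_iff_mem_nhds]
    intro τ₀ hτ₀
    have hnear : ∀ᶠ z in 𝓝 (toComplexVec k), MvPolynomial.aeval z h ≠ 0 :=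
      (continuous_aeval_vec h).continuousAt.eventually_ne hk0
    obtain ⟨ε, hε, hball⟩ := Metric.eventually_nhds_iff.mp hnear
    set M : ℝ := ‖γ τ₀‖ + 1 with hM
    have hMpos : 0 < M := by positivity
    have hfar : ∀ᶠ τ in 𝓝 τ₀, ‖γ τ‖ < M :=
      hγc.norm.continuousAt.eventually_lt continuousAt_const (by simp [hM])
    have hK : IsCompact (Metric.closedBall (0 : ℂ) (M / ε) ∩ {t : ℂ | 0 ≤ t.im}) :=
      (isCompact_closedBall _ _).inter_right (isClosed_le continuous_const Complex.continuous_im)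
    have hclose := hK.eventually_forall_of_forall_eventually (x₀ := τ₀)
      (P := fun τ t => P τ t ≠ 0)
      fun t ht => hPc.continuousAt.eventually_ne (hτ₀ t ht.2)
    filter_upwards [hfar, hclose] with τ hτ1 hτ2 t ht
    by_cases hle : ‖t‖ ≤ M / ε
    · exact hτ2 t ⟨by simpa using hle, ht⟩
    have hlt := not_le.mp hle
    have ht0 : 0 < ‖t‖ := lt_trans (by positivity) hlt
    have htne : t ≠ 0 := norm_pos_iff.mp ht0
    have heq : γ τ + t • toComplexVec k = t • (toComplexVec k + t⁻¹ • γ τ) := by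
      rw [smul_add, smul_smul, mul_inv_cancel₀ htne, one_smul, add_comm]
    simp only [hP]
    rw [heq, aeval_smul_of_isHomogeneous hh]
    refine mul_ne_zero (pow_ne_zero _ htne) (hball ?_)
    rw [dist_eq_norm, add_sub_cancel_left, norm_smul, norm_inv, inv_mul_lt_iff₀ ht0]
    rw [div_lt_iff₀ hε] at hlt
    linarith
  have huniv : B = Set.univ := IsClopen.eq_univ ⟨hBclosed, hBopen⟩ ⟨0, hB0⟩
  have h1 : (1 : ℝ) ∈ B := huniv ▸ Set.mem_univ _
  simpa [hP, hγ] using h1 t ht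

theorem NonvanishingDirection.add_of_mem_closure (hh : h.IsHomogeneous d)
    (hhyp : IsHyperbolicWrt h e) {k₁ k : Fin m → ℝ}
    (hk₁ : ∀ s : ℝ, 0 ≤ s → NonvanishingDirection h (e + s • k₁))
    (hk : k ∈ closure (hypCone h e)) {s : ℝ} (hs : 0 ≤ s) :
    NonvanishingDirection h (e + k₁ + s • k) := by
  intro x
  have hy : NonvanishingDirection h (e + k₁) := by simpa using hk₁ 1 zero_le_one
  have hbound : ∀ k' ∈ closure (hypCone h e),
      ‖MvPolynomial.aeval (toComplexVec (e + k₁)) h‖ ≤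
      ‖MvPolynomial.aeval (toComplexVec x + (Complex.I * s) • toComplexVec k' +
        Complex.I • toComplexVec (e + k₁)) h‖ := by
    have hcl : IsClosed {k' : Fin m → ℝ | ‖MvPolynomial.aeval (toComplexVec (e + k₁)) h‖ ≤
      ‖MvPolynomial.aeval (toComplexVec x + (Complex.I * s) • toComplexVec k' +
        Complex.I • toComplexVec (e + k₁)) h‖} := by
      refine isClosed_le continuous_const ((continuous_aeval_vec h).comp ?_).norm
      have := continuous_toComplexVec (m := m)
      fun_prop
    refine fun k' hk' => closure_minimal (fun k' hk' => ?_) hcl hk'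
    have := norm_aeval_mul_pow_le hh (toComplexVec x + (Complex.I * s) • toComplexVec k')
      (toComplexVec (e + k₁)) Complex.I zero_le_one fun ζ hζ => ?_
    · simpa using this
    have hζ' : ζ.im ≤ 0 := by
      by_contra! hpos
      have hne : (ζ.im : ℂ) ≠ 0 := by exact_mod_cast hpos.ne'
      refine aeval_ne_zero_of_mem_hypCone_of_path hh hhyp hk₁ hk'
        (ζ.im⁻¹ • (x + ζ.re • (e + k₁))) (t := Complex.I * (s / ζ.im : ℝ)) ?_ ?_
      · simp only [Complex.mul_im, Complex.I_re, Complex.I_im, Complex.ofReal_re]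
        simp only [zero_mul, one_mul, zero_add]
        positivity
      · have heq : toComplexVec x + (Complex.I * s) • toComplexVec k' +
            ζ • toComplexVec (e + k₁) = (ζ.im : ℂ) •
            (toComplexVec (ζ.im⁻¹ • (x + ζ.re • (e + k₁))) +
              Complex.I • toComplexVec (e + k₁) +
              (Complex.I * (s / ζ.im : ℝ)) • toComplexVec k') := by
          ext j
          simp only [toComplexVec, Pi.add_apply, Pi.smul_apply, smul_eq_mul]
          push_cast
          field_simp
          conv_lhs => rw [← Complex.re_add_im ζ]
          ring
        rw [heq, aeval_smul_of_isHomogeneous hh] at hζ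
        exact (mul_eq_zero.mp hζ).resolve_left (pow_ne_zero _ hne)
    have := Complex.abs_im_le_norm (Complex.I - ζ)
    rw [Complex.sub_im, Complex.I_im] at this
    linarith [le_abs_self (1 - ζ.im)]
  have hpos := (norm_pos_iff.mpr (hy.aeval_self_ne_zero hh)).trans_le (hbound k hk)
  convert norm_pos_iff.mp hpos using 3
  ext j
  simp only [toComplexVec, Pi.add_apply, Pi.smul_apply, smul_eq_mul]
  push_cast
  ring

theorem nonvanishingDirection_of_mem_span (hh : h.IsHomogeneous d) (hhyp : IsHyperbolicWrt h e)
    {k : Fin m → ℝ} (hk : k ∈ Submodule.span NNReal (closure (hypCone h e))) :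
    NonvanishingDirection h (e + k) := by
  have key : ∀ k₁ : Fin m → ℝ, (∀ s : ℝ, 0 ≤ s → NonvanishingDirection h (e + s • k₁)) →
      ∀ s : ℝ, 0 ≤ s → NonvanishingDirection h (e + s • (k₁ + k)) := by
    induction hk using Submodule.span_induction with
    | mem k hk =>
      intro k₁ hk₁ s hs
      rw [smul_add, ← add_assoc]
      refine NonvanishingDirection.add_of_mem_closure hh hhyp (fun r hr => ?_) hk hs
      rw [smul_smul]
      exact hk₁ _ (mul_nonneg hr hs)
    | zero => simp
    | add k k' _ _ ih ih' =>
      intro k₁ hk₁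
      rw [← add_assoc]
      exact ih' _ (ih _ hk₁)
    | smul c k _ ih =>
      intro k₁ hk₁ s hs
      rcases eq_or_ne c 0 with rfl | hc
      · simpa using hk₁ s hs
      have hc' : (c : ℝ) ≠ 0 := by exact_mod_cast hc
      have := ih ((c : ℝ)⁻¹ • k₁) (fun r hr => ?_) (s * c) (mul_nonneg hs c.2)
      · convert this using 2
        rw [NNReal.smul_def, smul_add, smul_add, smul_smul, smul_smul, mul_inv_cancel_right₀ hc']
      · rw [smul_smul]
        exact hk₁ _ (mul_nonneg hr (inv_nonneg.mpr c.2))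
  simpa using key 0 (by simpa using fun _ _ => hhyp.nonvanishingDirection) 1 zero_le_one

theorem real_smul_mem_span {s : Set (Fin m → ℝ)} {k : Fin m → ℝ}
    (hk : k ∈ Submodule.span NNReal s) {c : ℝ} (hc : 0 ≤ c) : c • k ∈ Submodule.span NNReal s :=
  Submodule.smul_mem _ (⟨c, hc⟩ : NNReal) hk

theorem aeval_ne_zero_of_mem_span (hh : h.IsHomogeneous d) (hhyp : IsHyperbolicWrt h e)
    {k u v : Fin m → ℝ} (hk : k ∈ Submodule.span NNReal (closure (hypCone h e)))
    (hu : u ∈ Submodule.span NNReal (closure (hypCone h e)))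
    (hv : v ∈ Submodule.span NNReal (closure (hypCone h e))) {a b : ℂ} (N : ℝ)
    (ha : 0 ≤ N * a.im + a.re) (hb : 0 ≤ N * b.im + b.re) :
    MvPolynomial.aeval
      (toComplexVec (e + k) + b • toComplexVec v + a • toComplexVec u) h ≠ 0 := by
  have hgood := nonvanishingDirection_of_mem_span hh hhyp
    (add_mem (add_mem hk (real_smul_mem_span hu ha)) (real_smul_mem_span hv hb))
    (N • (e + k) + (N * a.re - a.im) • u + (N * b.re - b.im) • v)
  intro h0
  refine hgood ?_
  have : toComplexVec (N • (e + k) + (N * a.re - a.im) • u + (N * b.re - b.im) • v) +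
      Complex.I • toComplexVec
        (e + (k + (N * a.im + a.re) • u + (N * b.im + b.re) • v)) =
      ((N : ℂ) + Complex.I) •
        (toComplexVec (e + k) + b • toComplexVec v + a • toComplexVec u) := by
    ext j
    simp only [toComplexVec, Pi.add_apply, Pi.smul_apply, smul_eq_mul]
    apply Complex.ext <;> simp <;> ring
  rw [this, aeval_smul_of_isHomogeneous hh, h0, mul_zero]

/-- The derivative of a polynomial in the constant direction `u`. -/
noncomputable def dirDeriv (u : Fin m → ℝ) :
    Derivation ℝ (MvPolynomial (Fin m) ℝ) (MvPolynomial (Fin m) ℝ) :=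
  MvPolynomial.mkDerivation ℝ fun j => MvPolynomial.C (u j)

theorem hasDerivAt_aeval_line {𝕜 : Type*} [NontriviallyNormedField 𝕜] [Algebra ℝ 𝕜]
    (p : MvPolynomial (Fin m) ℝ) (z : Fin m → 𝕜) (u : Fin m → ℝ) (t : 𝕜) :
    HasDerivAt (fun t : 𝕜 => MvPolynomial.aeval (z + t • fun j => algebraMap ℝ 𝕜 (u j)) p)
      (MvPolynomial.aeval (z + t • fun j => algebraMap ℝ 𝕜 (u j)) (dirDeriv u p)) t := by
  induction p using MvPolynomial.induction_on with
  | C a => simpa [dirDeriv] using hasDerivAt_const t (algebraMap ℝ 𝕜 a)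
  | add p q hp hq =>
    simp only [map_add]
    exact hp.add hq
  | mul_X p j hp =>
    have hX : HasDerivAt (fun t : 𝕜 => z j + t * algebraMap ℝ 𝕜 (u j)) (algebraMap ℝ 𝕜 (u j)) t := by
      simpa using ((hasDerivAt_id t).mul_const (algebraMap ℝ 𝕜 (u j))).const_add (z j)
    have hD : dirDeriv u (MvPolynomial.X j) = MvPolynomial.C (u j) :=
      MvPolynomial.mkDerivation_X _ _ _
    have := hp.mul hX
    simp only [Derivation.leibniz, hD, map_mul, map_add, smul_eq_mul, MvPolynomial.aeval_X,
      MvPolynomial.aeval_C, Pi.add_apply, Pi.smul_apply]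
    exact this.congr_deriv (by ring)

theorem hasDerivAt_aeval_complex_line (p : MvPolynomial (Fin m) ℝ) (z : Fin m → ℂ)
    (u : Fin m → ℝ) (t : ℂ) :
    HasDerivAt (fun t : ℂ => MvPolynomial.aeval (z + t • toComplexVec u) p)
      (MvPolynomial.aeval (z + t • toComplexVec u) (dirDeriv u p)) t :=
  hasDerivAt_aeval_line p z u t

theorem hasDerivAt_aeval_real_line (p : MvPolynomial (Fin m) ℝ) (x u : Fin m → ℝ) (t : ℝ) :
    HasDerivAt (fun t : ℝ => MvPolynomial.aeval (x + t • u) p)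
      (MvPolynomial.aeval (x + t • u) (dirDeriv u p)) t :=
  hasDerivAt_aeval_line p x u t

theorem aeval_dirDeriv_div_aeval (p : MvPolynomial (Fin m) ℝ) (z : Fin m → ℂ)
    (u : Fin m → ℝ) (hz : MvPolynomial.aeval z p ≠ 0) :
    MvPolynomial.aeval z (dirDeriv u p) / MvPolynomial.aeval z p =
      ((linePoly p z (toComplexVec u)).roots.map fun ζ => 1 / (0 - ζ)).sum := by
  have h0 : (linePoly p z (toComplexVec u)).eval 0 = MvPolynomial.aeval z p := by
    simp [eval_linePoly]
  rw [← (IsAlgClosed.splits (linePoly p z (toComplexVec u))).eval_derivative_div_eval_of_ne_zero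
    (by rwa [h0]), h0]
  congr 1
  have h1 := (linePoly p z (toComplexVec u)).hasDerivAt 0
  simp only [eval_linePoly] at h1
  have h2 := hasDerivAt_aeval_complex_line p z u 0
  simpa using h2.unique h1

theorem im_aeval_dirDeriv_div_aeval_nonpos (hh : h.IsHomogeneous d) (hhyp : IsHyperbolicWrt h e)
    {k u v : Fin m → ℝ} (hk : k ∈ Submodule.span NNReal (closure (hypCone h e)))
    (hu : u ∈ Submodule.span NNReal (closure (hypCone h e)))
    (hv : v ∈ Submodule.span NNReal (closure (hypCone h e))) {ε : ℝ} (hε : 0 ≤ ε) :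
    (MvPolynomial.aeval (toComplexVec (e + k) + (Complex.I * ε) • toComplexVec v) (dirDeriv u h) /
      MvPolynomial.aeval (toComplexVec (e + k) + (Complex.I * ε) • toComplexVec v) h).im ≤ 0 := by
  have hz := aeval_ne_zero_of_mem_span hh hhyp hk hu hv (a := 0) (b := Complex.I * ε) 1
    (by simp) (by simpa using hε)
  rw [zero_smul, add_zero] at hz
  rw [aeval_dirDeriv_div_aeval _ _ _ hz]
  have := map_multiset_sum Complex.imAddGroupHom
    ((linePoly h (toComplexVec (e + k) + (Complex.I * ε) • toComplexVec v)
      (toComplexVec u)).roots.map fun ζ => 1 / (0 - ζ))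
  rw [← Complex.coe_imAddGroupHom, this, Multiset.map_map]
  refine Multiset.sum_induction (· ≤ 0) _ (fun _ _ => add_nonpos) le_rfl fun r hr => ?_
  obtain ⟨ζ, hζ, rfl⟩ := Multiset.mem_map.mp hr
  have hroot := Polynomial.isRoot_of_mem_roots hζ
  rw [Polynomial.IsRoot, eval_linePoly] at hroot
  have him : ζ.im ≤ 0 := by
    by_contra! hpos
    refine aeval_ne_zero_of_mem_span hh hhyp hk hu hv (a := ζ) (b := Complex.I * ε)
      (max 0 (-ζ.re / ζ.im)) ?_ ?_ hroot
    · have := (div_le_iff₀ hpos).mp (le_max_right 0 (-ζ.re / ζ.im))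
      linarith
    · simpa using mul_nonneg (le_max_left 0 (-ζ.re / ζ.im)) hε
  simp only [Function.comp, Complex.coe_imAddGroupHom, one_div, zero_sub, Complex.inv_im,
    Complex.neg_im, neg_neg]
  exact div_nonpos_of_nonpos_of_nonneg him (Complex.normSq_nonneg _)

theorem aeval_dirDeriv_div_aeval_nonneg (hh : h.IsHomogeneous d) (hhyp : IsHyperbolicWrt h e)
    {k u : Fin m → ℝ} (hk : k ∈ Submodule.span NNReal (closure (hypCone h e)))
    (hu : u ∈ Submodule.span NNReal (closure (hypCone h e))) :
    0 ≤ (MvPolynomial.aeval (e + k) (dirDeriv u h) / MvPolynomial.aeval (e + k) h : ℝ) := by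
  have hne : ∀ (ζ : ℂ) (N : ℝ), 0 ≤ N * ζ.im + ζ.re →
      MvPolynomial.aeval (toComplexVec (e + k) + ζ • toComplexVec u) h ≠ 0 := by
    intro ζ N hN
    simpa using aeval_ne_zero_of_mem_span hh hhyp hk hu hu (a := ζ) (b := 0) N hN (by simp)
  have hz := hne 0 0 (by simp)
  rw [zero_smul, add_zero] at hz
  have hsum := aeval_dirDeriv_div_aeval h _ u hz
  rw [aeval_toComplexVec, aeval_toComplexVec, ← Complex.ofReal_div] at hsum
  rw [← Complex.ofReal_re (_ / _), hsum]
  have := map_multiset_sum Complex.reAddGroupHom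
    ((linePoly h (toComplexVec (e + k)) (toComplexVec u)).roots.map fun ζ => 1 / (0 - ζ))
  rw [← Complex.coe_reAddGroupHom, this, Multiset.map_map]
  refine Multiset.sum_nonneg fun r hr => ?_
  obtain ⟨ζ, hζ, rfl⟩ := Multiset.mem_map.mp hr
  have hroot := Polynomial.isRoot_of_mem_roots hζ
  rw [Polynomial.IsRoot, eval_linePoly] at hroot
  have hre : ζ.re ≤ 0 := by
    by_contra! hpos
    exact hne ζ 0 (by linarith) hroot
  simp only [Function.comp, Complex.coe_reAddGroupHom, one_div, zero_sub, Complex.inv_re,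
    Complex.neg_re]
  exact div_nonneg (by linarith) (Complex.normSq_nonneg _)

theorem aeval_dirDeriv_dirDeriv_mul_le (hh : h.IsHomogeneous d) (hhyp : IsHyperbolicWrt h e)
    {k u v : Fin m → ℝ} (hk : k ∈ Submodule.span NNReal (closure (hypCone h e)))
    (hu : u ∈ Submodule.span NNReal (closure (hypCone h e)))
    (hv : v ∈ Submodule.span NNReal (closure (hypCone h e))) :
    ((MvPolynomial.aeval (e + k) (dirDeriv v (dirDeriv u h)) * MvPolynomial.aeval (e + k) h -
      MvPolynomial.aeval (e + k) (dirDeriv u h) * MvPolynomial.aeval (e + k) (dirDeriv v h)) /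
      MvPolynomial.aeval (e + k) h ^ 2 : ℝ) ≤ 0 := by
  have hne : MvPolynomial.aeval (toComplexVec (e + k)) h ≠ 0 :=
    (nonvanishingDirection_of_mem_span hh hhyp hk).aeval_self_ne_zero hh
  set z := toComplexVec (e + k) with hz
  have hA := hasDerivAt_aeval_complex_line (dirDeriv u h) z v 0
  have hB := hasDerivAt_aeval_complex_line h z v 0
  have hq := hA.div hB (by simpa using hne)
  have hI : HasDerivAt (fun b : ℂ => Complex.I * b) Complex.I 0 := by
    simpa using (hasDerivAt_id (0 : ℂ)).const_mul Complex.I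
  have hc := (HasDerivAt.comp (0 : ℂ) (h := fun b : ℂ => Complex.I * b)
    (by simpa only [mul_zero] using hq) hI)
  have hr := Complex.imCLM.hasFDerivAt.comp_hasDerivAt (0 : ℝ)
    (HasDerivAt.comp_ofReal (z := 0) (by simpa only [Complex.ofReal_zero] using hc))
  have hlim := hr.tendsto_slope_zero_right
  simp only [zero_smul, add_zero, hz, aeval_toComplexVec] at hlim
  norm_cast at hlim
  simp only [Complex.imCLM_apply, Complex.im_ofReal_mul, Complex.I_im, mul_one] at hlim
  refine le_of_tendsto hlim ?_
  filter_upwards [self_mem_nhdsWithin] with ε hε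
  have hε' : 0 < ε := hε
  have hle := im_aeval_dirDeriv_div_aeval_nonpos hh hhyp hk hu hv hε'.le
  have h0 : (MvPolynomial.aeval (toComplexVec (e + k)) (dirDeriv u h) /
      MvPolynomial.aeval (toComplexVec (e + k)) h).im = 0 := by
    rw [aeval_toComplexVec, aeval_toComplexVec, ← Complex.ofReal_div, Complex.ofReal_im]
  refine mul_nonpos_of_nonneg_of_nonpos (inv_nonneg.mpr hε'.le) ?_
  simpa [h0] using hle
theorem aeval_pos_of_mem_span (hh : h.IsHomogeneous d) (hhyp : IsHyperbolicWrt h e)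
    (hpos : 0 < (MvPolynomial.aeval e h : ℝ)) {k : Fin m → ℝ}
    (hk : k ∈ Submodule.span NNReal (closure (hypCone h e))) :
    0 < (MvPolynomial.aeval (e + k) h : ℝ) := by
  have hcont : Continuous fun t : ℝ => (MvPolynomial.aeval (e + t • k) h : ℝ) :=
    continuous_iff_continuousAt.mpr fun t => (hasDerivAt_aeval_real_line h e k t).continuousAt
  by_contra! hneg
  obtain ⟨t, ht, ht0⟩ := intermediate_value_Icc' (zero_le_one (α := ℝ)) hcont.continuousOn
    (show (0 : ℝ) ∈ _ from ⟨by simpa using hneg, by simpa using hpos.le⟩)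
  have := (nonvanishingDirection_of_mem_span hh hhyp
    (real_smul_mem_span hk ht.1)).aeval_self_ne_zero hh
  rw [aeval_toComplexVec] at this
  exact this (by exact_mod_cast ht0)

theorem aeval_le_aeval_add (hh : h.IsHomogeneous d) (hhyp : IsHyperbolicWrt h e)
    (hpos : 0 < (MvPolynomial.aeval e h : ℝ)) {k u : Fin m → ℝ}
    (hk : k ∈ Submodule.span NNReal (closure (hypCone h e)))
    (hu : u ∈ Submodule.span NNReal (closure (hypCone h e))) :
    (MvPolynomial.aeval (e + k) h : ℝ) ≤ MvPolynomial.aeval (e + k + u) h := by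
  have hmono : MonotoneOn (fun t : ℝ => (MvPolynomial.aeval (e + k + t • u) h : ℝ))
      (Set.Ici 0) := by
    refine monotoneOn_of_hasDerivWithinAt_nonneg (convex_Ici 0)
      (fun t _ => (hasDerivAt_aeval_real_line h (e + k) u t).continuousAt.continuousWithinAt)
      (fun t _ => (hasDerivAt_aeval_real_line h (e + k) u t).hasDerivWithinAt) fun t ht => ?_
    rw [interior_Ici] at ht
    have hmem := add_mem hk (real_smul_mem_span hu (le_of_lt ht))
    have h1 := aeval_dirDeriv_div_aeval_nonneg hh hhyp hmem hu
    have h2 := aeval_pos_of_mem_span hh hhyp hpos hmem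
    rw [← add_assoc] at h1 h2
    exact (mul_nonneg h1 h2.le).trans_eq (div_mul_cancel₀ _ h2.ne')
  simpa using hmono Set.self_mem_Ici (zero_le_one' ℝ) zero_le_one

theorem aeval_dirDeriv_div_aeval_add_le (hh : h.IsHomogeneous d) (hhyp : IsHyperbolicWrt h e)
    (hpos : 0 < (MvPolynomial.aeval e h : ℝ)) {k u v : Fin m → ℝ}
    (hk : k ∈ Submodule.span NNReal (closure (hypCone h e)))
    (hu : u ∈ Submodule.span NNReal (closure (hypCone h e)))
    (hv : v ∈ Submodule.span NNReal (closure (hypCone h e))) :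
    (MvPolynomial.aeval (e + k + v) (dirDeriv u h) / MvPolynomial.aeval (e + k + v) h : ℝ) ≤
      MvPolynomial.aeval (e + k) (dirDeriv u h) / MvPolynomial.aeval (e + k) h := by
  have hmem : ∀ t : ℝ, 0 ≤ t → k + t • v ∈ Submodule.span NNReal (closure (hypCone h e)) :=
    fun t ht => add_mem hk (real_smul_mem_span hv ht)
  have hd : ∀ t : ℝ, 0 ≤ t → HasDerivAt (fun t : ℝ =>
      (MvPolynomial.aeval (e + k + t • v) (dirDeriv u h) /
        MvPolynomial.aeval (e + k + t • v) h : ℝ)) _ t := fun t ht =>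
    (hasDerivAt_aeval_real_line (dirDeriv u h) (e + k) v t).fun_div
      (hasDerivAt_aeval_real_line h (e + k) v t) (by
        rw [add_assoc]
        exact (aeval_pos_of_mem_span hh hhyp hpos (hmem t ht)).ne')
  have hanti : AntitoneOn (fun t : ℝ => (MvPolynomial.aeval (e + k + t • v) (dirDeriv u h) /
      MvPolynomial.aeval (e + k + t • v) h : ℝ)) (Set.Ici 0) := by
    refine antitoneOn_of_hasDerivWithinAt_nonpos (convex_Ici 0)
      (fun t ht => (hd t ht).continuousAt.continuousWithinAt)
      (fun t ht => (hd t (interior_subset ht)).hasDerivWithinAt) fun t ht => ?_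
    rw [add_assoc]
    exact aeval_dirDeriv_dirDeriv_mul_le hh hhyp (hmem t (interior_subset ht)) hu hv
  simpa using hanti Set.self_mem_Ici (zero_le_one' ℝ) zero_le_one

/-- A hyperbolic polynomial is log-submodular along directions of its closed cone. -/
theorem aeval_add_add_mul_aeval_le (hh : h.IsHomogeneous d) (hhyp : IsHyperbolicWrt h e)
    (hpos : 0 < (MvPolynomial.aeval e h : ℝ)) {k u v : Fin m → ℝ}
    (hk : k ∈ Submodule.span NNReal (closure (hypCone h e)))
    (hu : u ∈ Submodule.span NNReal (closure (hypCone h e)))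
    (hv : v ∈ Submodule.span NNReal (closure (hypCone h e))) :
    (MvPolynomial.aeval (e + k + v + u) h * MvPolynomial.aeval (e + k) h : ℝ) ≤
      MvPolynomial.aeval (e + k + u) h * MvPolynomial.aeval (e + k + v) h := by
  have hpos' : ∀ k ∈ Submodule.span NNReal (closure (hypCone h e)),
      0 < (MvPolynomial.aeval (e + k) h : ℝ) :=
    fun k hk => aeval_pos_of_mem_span hh hhyp hpos hk
  have hmem : ∀ t : ℝ, 0 ≤ t → k + t • u ∈ Submodule.span NNReal (closure (hypCone h e)) :=
    fun t ht => add_mem hk (real_smul_mem_span hu ht)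
  have hp1 : ∀ t : ℝ, 0 ≤ t → 0 < (MvPolynomial.aeval (e + k + t • u) h : ℝ) := fun t ht => by
    rw [add_assoc]
    exact hpos' _ (hmem t ht)
  have hp2 : ∀ t : ℝ, 0 ≤ t → 0 < (MvPolynomial.aeval (e + k + v + t • u) h : ℝ) := fun t ht => by
    rw [add_right_comm _ v, add_assoc e, add_assoc e]
    exact hpos' _ (add_mem (hmem t ht) hv)
  have hd : ∀ t : ℝ, 0 ≤ t → HasDerivAt (fun t : ℝ =>
      (MvPolynomial.aeval (e + k + v + t • u) h / MvPolynomial.aeval (e + k + t • u) h : ℝ)) _ t :=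
    fun t ht => (hasDerivAt_aeval_real_line h (e + k + v) u t).fun_div
      (hasDerivAt_aeval_real_line h (e + k) u t) (hp1 t ht).ne'
  have hanti : AntitoneOn (fun t : ℝ =>
      (MvPolynomial.aeval (e + k + v + t • u) h / MvPolynomial.aeval (e + k + t • u) h : ℝ))
      (Set.Ici 0) := by
    refine antitoneOn_of_hasDerivWithinAt_nonpos (convex_Ici 0)
      (fun t ht => (hd t ht).continuousAt.continuousWithinAt)
      (fun t ht => (hd t (interior_subset ht)).hasDerivWithinAt) fun t ht => ?_
    have ht0 : 0 ≤ t := interior_subset ht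
    have hle := aeval_dirDeriv_div_aeval_add_le hh hhyp hpos (hmem t ht0) hu hv
    rw [← add_assoc, add_right_comm _ _ v, div_le_div_iff₀ (hp2 t ht0) (hp1 t ht0)] at hle
    refine div_nonpos_of_nonpos_of_nonneg ?_ (sq_nonneg _)
    linarith
  have hle := hanti Set.self_mem_Ici (zero_le_one' ℝ) zero_le_one
  simp only [zero_smul, one_smul, add_zero] at hle
  have h1 := hp1 1 zero_le_one
  have h0 := hp1 0 le_rfl
  rw [one_smul] at h1
  rw [zero_smul, add_zero] at h0
  rw [div_le_div_iff₀ h1 h0] at hle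
  linarith

end

open Filter in
theorem Polynomial.natDegree_le_of_eval_le {P Q : Polynomial ℝ} (hP : P ≠ 0)
    (hPQ : ∀ t : ℝ, 0 ≤ t → 0 ≤ P.eval t ∧ P.eval t ≤ Q.eval t) :
    P.natDegree ≤ Q.natDegree := by
  by_contra! hlt
  have hlittle := Polynomial.isLittleO_atTop_of_degree_lt _ _ (Polynomial.degree_lt_degree hlt)
  have hbig : P.eval =O[atTop] Q.eval := by
    refine Asymptotics.IsBigO.of_bound 1 ?_
    filter_upwards [eventually_ge_atTop 0] with t ht
    obtain ⟨h0, h1⟩ := hPQ t ht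
    rwa [one_mul, Real.norm_of_nonneg h0, Real.norm_of_nonneg (h0.trans h1)]
  exact hbig.not_isLittleO (Polynomial.eventually_atTop_not_isRoot P hP).frequently hlittle

theorem natDegree_linePoly_polymatroid {m n d : ℕ} {h : MvPolynomial (Fin m) ℝ} {e : Fin m → ℝ}
    (hh : h.IsHomogeneous d) (hhyp : IsHyperbolicWrt h e)
    (hpos : 0 < (MvPolynomial.aeval e h : ℝ)) {E : Fin n → Fin m → ℝ}
    (hE : ∀ i, E i ∈ closure (hypCone h e)) :
    (∀ S T : Finset (Fin n), S ⊆ T →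
      (linePoly h e (∑ i ∈ S, E i)).natDegree ≤ (linePoly h e (∑ i ∈ T, E i)).natDegree) ∧
    ∀ S T : Finset (Fin n),
      (linePoly h e (∑ i ∈ S ∪ T, E i)).natDegree + (linePoly h e (∑ i ∈ S ∩ T, E i)).natDegree ≤
      (linePoly h e (∑ i ∈ S, E i)).natDegree + (linePoly h e (∑ i ∈ T, E i)).natDegree := by
  have hmem : ∀ (S : Finset (Fin n)) (t : ℝ), 0 ≤ t →
      t • ∑ i ∈ S, E i ∈ Submodule.span NNReal (closure (hypCone h e)) := fun S t ht =>
    real_smul_mem_span (Submodule.sum_mem _ fun i _ => Submodule.subset_span (hE i)) ht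
  have hpos' : ∀ (S : Finset (Fin n)) (t : ℝ), 0 ≤ t →
      0 < (linePoly h e (∑ i ∈ S, E i)).eval t := fun S t ht => by
    rw [eval_linePoly]
    exact aeval_pos_of_mem_span hh hhyp hpos (hmem S t ht)
  have hne : ∀ S : Finset (Fin n), linePoly h e (∑ i ∈ S, E i) ≠ 0 := fun S h0 => by
    simpa [h0] using hpos' S 0 le_rfl
  constructor
  · intro S T hST
    refine Polynomial.natDegree_le_of_eval_le (hne S) fun t ht => ⟨(hpos' S t ht).le, ?_⟩
    rw [eval_linePoly, eval_linePoly, ← Finset.sum_sdiff hST, smul_add,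
      add_comm (t • ∑ i ∈ T \ S, E i), ← add_assoc]
    exact aeval_le_aeval_add hh hhyp hpos (hmem S t ht) (hmem _ t ht)
  · intro S T
    rw [← Polynomial.natDegree_mul (hne _) (hne _), ← Polynomial.natDegree_mul (hne _) (hne _)]
    refine Polynomial.natDegree_le_of_eval_le (mul_ne_zero (hne _) (hne _)) fun t ht => ?_
    rw [Polynomial.eval_mul, Polynomial.eval_mul]
    refine ⟨mul_nonneg (hpos' _ t ht).le (hpos' _ t ht).le, ?_⟩
    have hS : ∑ i ∈ S, E i = ∑ i ∈ S ∩ T, E i + ∑ i ∈ S \ T, E i :=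
      (Finset.sum_inter_add_sum_sdiff S T E).symm
    have hT : ∑ i ∈ T, E i = ∑ i ∈ S ∩ T, E i + ∑ i ∈ T \ S, E i := by
      rw [Finset.inter_comm]
      exact (Finset.sum_inter_add_sum_sdiff T S E).symm
    have hU : ∑ i ∈ S ∪ T, E i =
        ∑ i ∈ S ∩ T, E i + ∑ i ∈ T \ S, E i + ∑ i ∈ S \ T, E i := by
      rw [← hT, ← Finset.sdiff_union_self_eq_union, Finset.sum_union Finset.sdiff_disjoint,
        add_comm]
    simp only [eval_linePoly]
    rw [hS, hT, hU]
    simp only [smul_add, ← add_assoc]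
    exact aeval_add_add_mul_aeval_le hh hhyp hpos (hmem _ t ht) (hmem _ t ht) (hmem _ t ht)

theorem IsHyperbolicWrt.neg {m : ℕ} {h : MvPolynomial (Fin m) ℝ} {e : Fin m → ℝ}
    (hhyp : IsHyperbolicWrt h e) : IsHyperbolicWrt (-h) e := by
  simpa [IsHyperbolicWrt] using hhyp

theorem hypCone_neg {m : ℕ} (h : MvPolynomial (Fin m) ℝ) (e : Fin m → ℝ) :
    hypCone (-h) e = hypCone h e := by
  simp [hypCone]

theorem stmt9 (m n d : ℕ) (h : MvPolynomial (Fin m) ℝ) (e : Fin m → ℝ)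
    (hhom : h.IsHomogeneous d) (hhyp : IsHyperbolicWrt h e)
    (E : Fin n → (Fin m → ℝ)) (hE : ∀ i, E i ∈ closure (hypCone h e)) :
    let r : Finset (Fin n) → ℕ := fun S =>
      (MvPolynomial.aeval (fun j => Polynomial.C (e j) +
        Polynomial.X * Polynomial.C (∑ i ∈ S, E i j)) h : Polynomial ℝ).natDegree
    r ∅ = 0 ∧ (∀ S T : Finset (Fin n), S ⊆ T → r S ≤ r T) ∧
      ∀ S T : Finset (Fin n), r (S ∪ T) + r (S ∩ T) ≤ r S + r T := by
  intro r
  have hr : ∀ S, r S = (linePoly h e (∑ i ∈ S, E i)).natDegree := fun S => by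
    simp only [r, linePoly, Finset.sum_apply]
  have hempty : r ∅ = 0 := by
    have hconst : linePoly h e (∑ i ∈ (∅ : Finset (Fin n)), E i) =
        Polynomial.C (MvPolynomial.aeval e h) := by
      have := MvPolynomial.aeval_algebraMap_apply (Polynomial ℝ) e h
      simpa [linePoly, Function.comp_def] using this
    rw [hr, hconst, Polynomial.natDegree_C]
  refine ⟨hempty, ?_⟩
  simp only [hr]
  rcases lt_or_gt_of_ne hhyp.1 with hneg | hpos
  · have hlp : ∀ w, (linePoly (-h) e w).natDegree = (linePoly h e w).natDegree := fun w => by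
      simp [linePoly]
    have := natDegree_linePoly_polymatroid hhom.neg hhyp.neg
      (by simpa [MvPolynomial.aeval_eq_eval] using hneg) (E := E) (by simpa [hypCone_neg] using hE)
    simpa only [hlp] using this
  · exact natDegree_linePoly_polymatroid hhom hhyp
      (by simpa [MvPolynomial.aeval_eq_eval] using hpos) hE
end

section
/- Let V₈ be the Vámos matroid on {1,…,8}, whose bases are all 4-element subsets of {1,…,8} except the five sets {1,2,3,4}, {1,4,5,6}, {1,4,7,8}, {2,3,5,6}, {2,3,7,8}, and let h_{V₈}(x) = Σ_{B basis of V₈} Π_{j∈B} x_j be its bases generating polynomial. Then the polynomial p(x₁,…,x₈) = h_{V₈}(x₁+1, …, x₈+1) is a real zero polynomial. -/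
/-- The bases of the Vámos matroid on `{0,…,7}` (representing `{1,…,8}`): all 4-element
subsets except the five circuit-hyperplanes. -/
def vamosBases : Finset (Finset (Fin 8)) :=
  (Finset.univ.powersetCard 4).filter fun B =>
    B ∉ ({{0,1,2,3}, {0,3,4,5}, {0,3,6,7}, {1,2,4,5}, {1,2,6,7}} : Finset (Finset (Fin 8)))

/-- The bases generating polynomial of the Vámos matroid. -/
noncomputable def vamosPoly : MvPolynomial (Fin 8) ℝ :=
  ∑ B ∈ vamosBases, ∏ j ∈ B, MvPolynomial.X j

/-- The second elementary symmetric polynomial in three variables. -/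
def pairSum {R : Type*} [CommRing R] (b c d : R) : R := b * c + b * d + c * d

/-- The quartic obtained from the Vámos polynomial by identifying the variables in each of its
four pairs. -/
def vamosQuartic {R : Type*} [CommRing R] (a b c d : R) : R :=
  4 * (a + b + c + d) * (a * b * (c + d) + c * d * (a + b)) + c ^ 2 * d ^ 2

/-- A quarter of the derivative of `vamosQuartic` in its first variable. -/
def vamosCubic {R : Type*} [CommRing R] (a b c d : R) : R :=
  (2 * a + b + c + d) * pairSum b c d + b * c * d

/-- The discriminant of `vamosQuartic` as a quadratic in its first variable is nonnegative. -/
lemma vamosQuartic_discrim_nonneg (b c d : ℝ) :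
    0 ≤ ((b + c) * (b + d) * (c + d)) ^ 2 - pairSum b c d * (c * d) ^ 2 := by
  obtain ⟨t, ht⟩ : ∃ t, t = c + d := ⟨_, rfl⟩
  obtain ⟨q, hq⟩ : ∃ q, q = c * d := ⟨_, rfl⟩
  obtain ⟨e, he⟩ : ∃ e, e = b * t + q := ⟨_, rfl⟩
  have htq : 4 * q ≤ t ^ 2 := by rw [ht, hq]; nlinarith [sq_nonneg (c - d)]
  have key : e * q ^ 2 ≤ (b ^ 2 + e) ^ 2 * t ^ 2 := by
    rcases le_or_gt e 0 with h | h
    · nlinarith [mul_nonneg (neg_nonneg.2 h) (sq_nonneg q), sq_nonneg ((b ^ 2 + e) * t)]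
    rcases le_or_gt (q ^ 2) (4 * (b * t) ^ 2) with h2 | h2
    · have h3 : 4 * b ^ 2 * e * t ^ 2 ≤ (b ^ 2 + e) ^ 2 * t ^ 2 :=
        mul_le_mul_of_nonneg_right (by nlinarith [sq_nonneg (b ^ 2 - e)]) (sq_nonneg t)
      nlinarith [mul_le_mul_of_nonneg_left h2 h.le]
    · have hbt : b * t = e - q := by linarith
      rw [hbt] at h2
      have hq0 : 0 < q := by
        by_contra hn
        nlinarith
      have hqe : q < 2 * e := by nlinarith
      have h3 : e ^ 2 * t ^ 2 ≤ (b ^ 2 + e) ^ 2 * t ^ 2 :=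
        mul_le_mul_of_nonneg_right
          (pow_le_pow_left₀ h.le (by nlinarith [sq_nonneg b]) 2) (sq_nonneg t)
      have h4 : e ^ 2 * (4 * q) ≤ e ^ 2 * t ^ 2 := mul_le_mul_of_nonneg_left htq (sq_nonneg e)
      have h5 : e * q * q ≤ e * q * (4 * e) :=
        mul_le_mul_of_nonneg_left (by linarith) (mul_pos h hq0).le
      nlinarith
  have h1 : (b + c) * (b + d) * (c + d) = (b ^ 2 + e) * t := by rw [he, ht, hq]; ring
  have h2 : pairSum b c d = e := by rw [he, ht, hq]; unfold pairSum; ring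
  rw [h1, h2, ← hq]
  nlinarith

lemma pairSum_mul_vamosQuartic (a b c d : ℝ) :
    pairSum b c d * vamosQuartic a b c d = vamosCubic a b c d ^ 2 -
      (((b + c) * (b + d) * (c + d)) ^ 2 - pairSum b c d * (c * d) ^ 2) := by
  unfold vamosCubic vamosQuartic pairSum
  ring

/-- The cubic has three real zeros along a line, interlaced by the zeros of `pairSum`. -/
def HasInterlacedZeros (a b c d : ℝ → ℝ) : Prop :=
  ∃ m₁ m₂ m₃ : ℝ, m₁ < m₂ ∧ m₂ < m₃ ∧
    (vamosCubic (a m₁) (b m₁) (c m₁) (d m₁) = 0 ∧ 0 < pairSum (b m₁) (c m₁) (d m₁)) ∧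
    (vamosCubic (a m₂) (b m₂) (c m₂) (d m₂) = 0 ∧ pairSum (b m₂) (c m₂) (d m₂) < 0) ∧
    (vamosCubic (a m₃) (b m₃) (c m₃) (d m₃) = 0 ∧ 0 < pairSum (b m₃) (c m₃) (d m₃))

lemma HasInterlacedZeros.swap_left {a b c d : ℝ → ℝ} (h : HasInterlacedZeros a b c d) :
    HasInterlacedZeros a c b d := by
  have h1 : ∀ x y z w : ℝ, vamosCubic x z y w = vamosCubic x y z w := by
    intros; unfold vamosCubic pairSum; ring
  have h2 : ∀ y z w : ℝ, pairSum z y w = pairSum y z w := by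
    intros; unfold pairSum; ring
  simpa only [HasInterlacedZeros, h1 _ (b _) (c _), h2 (b _) (c _)] using h

lemma HasInterlacedZeros.swap_right {a b c d : ℝ → ℝ} (h : HasInterlacedZeros a b c d) :
    HasInterlacedZeros a b d c := by
  have h1 : ∀ x y z w : ℝ, vamosCubic x y w z = vamosCubic x y z w := by
    intros; unfold vamosCubic pairSum; ring
  have h2 : ∀ y z w : ℝ, pairSum y w z = pairSum y z w := by
    intros; unfold pairSum; ring
  simpa only [HasInterlacedZeros, h1 _ _ (c _) (d _), h2 _ (c _) (d _)] using h

lemma hasInterlacedZeros_of_lt {a₀ a₁ b₁ c₁ d₁ β γ δ : ℝ} (ha : 0 < a₁) (hb : 0 < b₁)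
    (hc : 0 < c₁) (hd : 0 < d₁) (hβγ : β < γ) (hγδ : γ < δ) :
    HasInterlacedZeros (fun t => a₁ * (t - a₀)) (fun t => b₁ * (t - β))
      (fun t => c₁ * (t - γ)) (fun t => d₁ * (t - δ)) := by
  set e : ℝ → ℝ := fun t => pairSum (b₁ * (t - β)) (c₁ * (t - γ)) (d₁ * (t - δ)) with he
  set q : ℝ → ℝ :=
    fun t => vamosCubic (a₁ * (t - a₀)) (b₁ * (t - β)) (c₁ * (t - γ)) (d₁ * (t - δ)) with hq
  have hec : Continuous e := by simp only [he, pairSum]; fun_prop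
  have hqc : Continuous q := by simp only [hq, vamosCubic, pairSum]; fun_prop
  have heβ : 0 < e β := by
    have : e β = (c₁ * (γ - β)) * (d₁ * (δ - β)) := by simp only [he, pairSum]; ring
    rw [this]
    have h1 : 0 < γ - β := by linarith
    have h2 : 0 < δ - β := by linarith
    positivity
  have heγ : e γ < 0 := by
    have : e γ = -((b₁ * (γ - β)) * (d₁ * (δ - γ))) := by simp only [he, pairSum]; ring
    rw [this, neg_lt_zero]
    have h1 : 0 < γ - β := by linarith
    have h2 : 0 < δ - γ := by linarith
    positivity
  have heδ : 0 < e δ := by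
    have : e δ = (b₁ * (δ - β)) * (c₁ * (δ - γ)) := by simp only [he, pairSum]; ring
    rw [this]
    have h1 : 0 < δ - β := by linarith
    have h2 : 0 < δ - γ := by linarith
    positivity
  obtain ⟨ν₁, ⟨h1β, h1γ⟩, hν₁⟩ := intermediate_value_Ioo' hβγ.le hec.continuousOn ⟨heγ, heβ⟩
  obtain ⟨ν₂, ⟨h2γ, h2δ⟩, hν₂⟩ := intermediate_value_Ioo hγδ.le hec.continuousOn ⟨heγ, heδ⟩
  have hE : 0 < b₁ * c₁ + b₁ * d₁ + c₁ * d₁ := by positivity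
  have hfac : ∀ t, e t = (b₁ * c₁ + b₁ * d₁ + c₁ * d₁) * ((t - ν₁) * (t - ν₂)) := by
    intro t
    obtain ⟨F, hF⟩ : ∃ F, F = -(b₁ * c₁ * (β + γ) + b₁ * d₁ * (β + δ) + c₁ * d₁ * (γ + δ)) :=
      ⟨_, rfl⟩
    obtain ⟨G, hG⟩ : ∃ G, G = b₁ * c₁ * (β * γ) + b₁ * d₁ * (β * δ) + c₁ * d₁ * (γ * δ) :=
      ⟨_, rfl⟩
    obtain ⟨E, hE'⟩ : ∃ E, E = b₁ * c₁ + b₁ * d₁ + c₁ * d₁ := ⟨_, rfl⟩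
    have hexp : ∀ t, e t = E * t ^ 2 + F * t + G := by
      intro t; simp only [he, pairSum, hF, hG, hE']; ring
    rw [hexp] at hν₁ hν₂
    have hs : E * (ν₁ + ν₂) + F = 0 := by
      have : (ν₂ - ν₁) * (E * (ν₁ + ν₂) + F) = 0 := by linear_combination hν₂ - hν₁
      exact (mul_eq_zero.1 this).resolve_left (by linarith)
    rw [hexp, ← hE']
    linear_combination (t - ν₁) * hs + hν₁
  have hq0 : ∀ t, e t = 0 → q t = (b₁ * (t - β)) * (c₁ * (t - γ)) * (d₁ * (t - δ)) := by
    intro t ht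
    have : q t = (2 * (a₁ * (t - a₀)) + b₁ * (t - β) + c₁ * (t - γ) + d₁ * (t - δ)) * e t +
        (b₁ * (t - β)) * (c₁ * (t - γ)) * (d₁ * (t - δ)) := rfl
    rw [this, ht]; ring
  have hqν₁ : 0 < q ν₁ := by
    rw [hq0 _ hν₁]
    have h1 : 0 < ν₁ - β := by linarith
    have h2 : 0 < γ - ν₁ := by linarith
    have h3 : 0 < δ - ν₁ := by linarith
    calc 0 < (b₁ * (ν₁ - β)) * (c₁ * (γ - ν₁)) * (d₁ * (δ - ν₁)) := by positivity
      _ = _ := by ring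
  have hqν₂ : q ν₂ < 0 := by
    rw [hq0 _ hν₂]
    have h1 : 0 < ν₂ - β := by linarith
    have h2 : 0 < ν₂ - γ := by linarith
    have h3 : 0 < δ - ν₂ := by linarith
    have : 0 < (b₁ * (ν₂ - β)) * (c₁ * (ν₂ - γ)) * (d₁ * (δ - ν₂)) := by positivity
    linarith
  obtain ⟨T, hTa, hTδ⟩ : ∃ T, a₀ < T ∧ δ < T := ⟨max a₀ δ + 1, by
    constructor <;> linarith [le_max_left a₀ δ, le_max_right a₀ δ]⟩
  obtain ⟨S, hSa, hSβ⟩ : ∃ S, S < a₀ ∧ S < β := ⟨min a₀ β - 1, by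
    constructor <;> linarith [min_le_left a₀ β, min_le_right a₀ β]⟩
  have hqT : 0 < q T := by
    have h1 : 0 < T - a₀ := by linarith
    have h2 : 0 < T - β := by linarith
    have h3 : 0 < T - γ := by linarith
    have h4 : 0 < T - δ := by linarith
    simp only [hq, vamosCubic, pairSum]
    positivity
  have hqS : q S < 0 := by
    have h1 : 0 < a₀ - S := by linarith
    have h2 : 0 < β - S := by linarith
    have h3 : 0 < γ - S := by linarith
    have h4 : 0 < δ - S := by linarith
    have : 0 < vamosCubic (a₁ * (a₀ - S)) (b₁ * (β - S)) (c₁ * (γ - S)) (d₁ * (δ - S)) := by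
      simp only [vamosCubic, pairSum]
      positivity
    have h5 : q S =
        -vamosCubic (a₁ * (a₀ - S)) (b₁ * (β - S)) (c₁ * (γ - S)) (d₁ * (δ - S)) := by
      simp only [hq, vamosCubic, pairSum]; ring
    linarith
  obtain ⟨m₁, ⟨_, h1⟩, hm₁⟩ :=
    intermediate_value_Ioo (by linarith : S ≤ ν₁) hqc.continuousOn ⟨hqS, hqν₁⟩
  obtain ⟨m₂, ⟨h2, h3⟩, hm₂⟩ :=
    intermediate_value_Ioo' (by linarith : ν₁ ≤ ν₂) hqc.continuousOn ⟨hqν₂, hqν₁⟩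
  obtain ⟨m₃, ⟨h4, _⟩, hm₃⟩ :=
    intermediate_value_Ioo (by linarith : ν₂ ≤ T) hqc.continuousOn ⟨hqν₂, hqT⟩
  refine ⟨m₁, m₂, m₃, by linarith, by linarith, ⟨hm₁, ?_⟩, ⟨hm₂, ?_⟩, ⟨hm₃, ?_⟩⟩
  · change 0 < e m₁
    rw [hfac]
    exact mul_pos hE (mul_pos_of_neg_of_neg (by linarith) (by linarith))
  · change e m₂ < 0
    rw [hfac]
    exact mul_neg_of_pos_of_neg hE (mul_neg_of_pos_of_neg (by linarith) (by linarith))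
  · change 0 < e m₃
    rw [hfac]
    exact mul_pos hE (mul_pos (by linarith) (by linarith))

lemma hasInterlacedZeros_of_ne {a₀ a₁ b₁ c₁ d₁ β γ δ : ℝ} (ha : 0 < a₁) (hb : 0 < b₁)
    (hc : 0 < c₁) (hd : 0 < d₁) (hβγ : β ≠ γ) (hβδ : β ≠ δ) (hγδ : γ ≠ δ) :
    HasInterlacedZeros (fun t => a₁ * (t - a₀)) (fun t => b₁ * (t - β))
      (fun t => c₁ * (t - γ)) (fun t => d₁ * (t - δ)) := by
  rcases lt_or_gt_of_ne hβγ with h1 | h1 <;> rcases lt_or_gt_of_ne hβδ with h2 | h2 <;>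
    rcases lt_or_gt_of_ne hγδ with h3 | h3
  · exact hasInterlacedZeros_of_lt ha hb hc hd h1 h3
  · exact (hasInterlacedZeros_of_lt ha hb hd hc h2 h3).swap_right
  · linarith
  · exact (hasInterlacedZeros_of_lt ha hd hb hc h2 h1).swap_left.swap_right
  · exact (hasInterlacedZeros_of_lt ha hc hb hd h1 h2).swap_left
  · linarith
  · exact (hasInterlacedZeros_of_lt ha hc hd hb h3 h2).swap_right.swap_left
  · exact (hasInterlacedZeros_of_lt ha hd hc hb h3 h1).swap_right.swap_left.swap_right

lemma im_real_div_sub_nonneg {A m : ℝ} {w : ℂ} (hA : A ≤ 0) (hw : 0 < w.im) :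
    0 ≤ ((A : ℂ) / (w - m)).im := by
  rw [Complex.div_im]
  have h : 0 ≤ Complex.normSq (w - m) := Complex.normSq_nonneg _
  simp only [Complex.ofReal_im, Complex.ofReal_re, Complex.sub_im, sub_zero, zero_mul, zero_div,
    zero_sub]
  rw [← neg_div, ← neg_mul]
  exact div_nonneg (mul_nonneg (by linarith) hw.le) h

/-- A real quartic with positive leading coefficient whose signs alternate weakly at three points
has no zeros in the upper half-plane. -/
lemma quartic_ne_zero_of_alternating {k₀ k₁ k₂ k₃ k₄ m₁ m₂ m₃ : ℝ} {f : ℝ → ℝ}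
    (hf : ∀ t, f t = k₀ + k₁ * t + k₂ * t ^ 2 + k₃ * t ^ 3 + k₄ * t ^ 4) (hk : 0 < k₄)
    (h12 : m₁ < m₂) (h23 : m₂ < m₃) (h1 : f m₁ ≤ 0) (h2 : 0 ≤ f m₂) (h3 : f m₃ ≤ 0)
    {w : ℂ} (hw : 0 < w.im) :
    (k₀ + k₁ * w + k₂ * w ^ 2 + k₃ * w ^ 3 + k₄ * w ^ 4 : ℂ) ≠ 0 := by
  intro h0
  have p12 : 0 < m₂ - m₁ := by linarith
  have p23 : 0 < m₃ - m₂ := by linarith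
  have p13 : 0 < m₃ - m₁ := by linarith
  have hA₁ : f m₁ / ((m₂ - m₁) * (m₃ - m₁)) ≤ 0 :=
    div_nonpos_of_nonpos_of_nonneg h1 (by positivity)
  have hA₂ : -f m₂ / ((m₂ - m₁) * (m₃ - m₂)) ≤ 0 :=
    div_nonpos_of_nonpos_of_nonneg (by linarith) (by positivity)
  have hA₃ : f m₃ / ((m₃ - m₁) * (m₃ - m₂)) ≤ 0 :=
    div_nonpos_of_nonpos_of_nonneg h3 (by positivity)
  have hne : ∀ m : ℝ, w - m ≠ 0 := by
    intro m hm
    have := congrArg Complex.im hm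
    simp at this
    linarith
  have key : (k₄ : ℂ) * w + ((k₃ + k₄ * (m₁ + m₂ + m₃) : ℝ) : ℂ) +
      ((f m₁ / ((m₂ - m₁) * (m₃ - m₁)) : ℝ) : ℂ) / (w - m₁) +
      ((-f m₂ / ((m₂ - m₁) * (m₃ - m₂)) : ℝ) : ℂ) / (w - m₂) +
      ((f m₃ / ((m₃ - m₁) * (m₃ - m₂)) : ℝ) : ℂ) / (w - m₃) = 0 := by
    have e1 := hne m₁
    have e2 := hne m₂
    have e3 := hne m₃
    have c12 : (m₂ - m₁ : ℂ) ≠ 0 := by exact_mod_cast p12.ne'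
    have c23 : (m₃ - m₂ : ℂ) ≠ 0 := by exact_mod_cast p23.ne'
    have c13 : (m₃ - m₁ : ℂ) ≠ 0 := by exact_mod_cast p13.ne'
    rw [hf, hf, hf]
    push_cast
    field_simp
    linear_combination (m₂ - m₁ : ℂ) * (m₃ - m₁) * (m₃ - m₂) * h0
  have him := congrArg Complex.im key
  have i1 := im_real_div_sub_nonneg (m := m₁) hA₁ hw
  have i2 := im_real_div_sub_nonneg (m := m₂) hA₂ hw
  have i3 := im_real_div_sub_nonneg (m := m₃) hA₃ hw
  simp only [Complex.add_im, Complex.im_ofReal_mul, Complex.ofReal_im, Complex.zero_im] at him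
  nlinarith [mul_pos hk hw]

/-- Along a line the quartic is a real polynomial of degree at most four in the parameter. -/
lemma vamosQuartic_line (a₀ a₁ b₀ b₁ c₀ c₁ d₀ d₁ : ℝ) :
    ∃ k₀ k₁ k₂ k₃ : ℝ,
      (∀ t : ℝ, vamosQuartic (a₁ * (t - a₀)) (b₁ * (t - b₀)) (c₁ * (t - c₀)) (d₁ * (t - d₀)) =
        k₀ + k₁ * t + k₂ * t ^ 2 + k₃ * t ^ 3 + vamosQuartic a₁ b₁ c₁ d₁ * t ^ 4) ∧
      (∀ w : ℂ, vamosQuartic (a₁ * (w - a₀)) (b₁ * (w - b₀)) (c₁ * (w - c₀)) (d₁ * (w - d₀)) =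
        k₀ + k₁ * w + k₂ * w ^ 2 + k₃ * w ^ 3 + (vamosQuartic a₁ b₁ c₁ d₁ : ℝ) * w ^ 4) := by
  obtain ⟨f, hf⟩ : ∃ f : ℝ → ℝ, f = fun t =>
    vamosQuartic (a₁ * (t - a₀)) (b₁ * (t - b₀)) (c₁ * (t - c₀)) (d₁ * (t - d₀)) := ⟨_, rfl⟩
  obtain ⟨k₄, h₄⟩ : ∃ k, k = vamosQuartic a₁ b₁ c₁ d₁ := ⟨_, rfl⟩
  obtain ⟨k₂, h₂⟩ : ∃ k, k = (f 1 + f (-1)) / 2 - f 0 - k₄ := ⟨_, rfl⟩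
  obtain ⟨k₃, h₃⟩ : ∃ k, k = ((f 2 - f 0 - 4 * k₂ - 16 * k₄) / 2 - (f 1 - f (-1)) / 2) / 3 :=
    ⟨_, rfl⟩
  refine ⟨f 0, (f 1 - f (-1)) / 2 - k₃, k₂, k₃, fun t => ?_, fun w => ?_⟩
  · rw [← h₄]
    simp only [h₃, h₂, h₄, hf, vamosQuartic]
    ring
  · rw [← h₄]
    simp only [h₃, h₂, h₄, hf, vamosQuartic]
    push_cast
    ring

lemma vamosQuartic_ne_zero_of_ne {a b c d : ℂ} (ha : 0 < a.im) (hb : 0 < b.im) (hc : 0 < c.im)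
    (hd : 0 < d.im) (hbc : b.re / b.im ≠ c.re / c.im) (hbd : b.re / b.im ≠ d.re / d.im)
    (hcd : c.re / c.im ≠ d.re / d.im) : vamosQuartic a b c d ≠ 0 := by
  have hz : ∀ z : ℂ, 0 < z.im →
      z = (z.im : ℂ) * (Complex.I - ((-(z.re / z.im) : ℝ) : ℂ)) := by
    intro z h
    apply Complex.ext
    · simp
      field_simp
    · simp
  obtain ⟨k₀, k₁, k₂, k₃, hr, hC⟩ := vamosQuartic_line (-(a.re / a.im)) a.im (-(b.re / b.im)) b.im
    (-(c.re / c.im)) c.im (-(d.re / d.im)) d.im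
  obtain ⟨m₁, m₂, m₃, h12, h23, ⟨hq₁, he₁⟩, ⟨hq₂, he₂⟩, ⟨hq₃, he₃⟩⟩ :=
    hasInterlacedZeros_of_ne (a₀ := -(a.re / a.im)) ha hb hc hd (neg_injective.ne hbc)
      (neg_injective.ne hbd) (neg_injective.ne hcd)
  have hle : ∀ x y z u : ℝ, vamosCubic x y z u = 0 → pairSum y z u * vamosQuartic x y z u ≤ 0 := by
    intro x y z u h
    rw [pairSum_mul_vamosQuartic, h]
    linarith [vamosQuartic_discrim_nonneg y z u]
  have hpos : 0 < vamosQuartic a.im b.im c.im d.im := by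
    unfold vamosQuartic
    positivity
  rw [hz a ha, hz b hb, hz c hc, hz d hd, hC]
  refine quartic_ne_zero_of_alternating hr hpos h12 h23 ?_ ?_ ?_ (by simp)
  · exact nonpos_of_mul_nonpos_right (hle _ _ _ _ hq₁) he₁
  · have := hle _ _ _ _ hq₂
    by_contra hn
    push Not at hn
    exact absurd this (not_le.2 (mul_pos_of_neg_of_neg he₂ hn))
  · exact nonpos_of_mul_nonpos_right (hle _ _ _ _ hq₃) he₃

/-- A complex quadratic splits into linear factors. -/
lemma exists_quadratic_factorization {P : ℂ} (hP : P ≠ 0) (Q R : ℂ) :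
    ∃ r s : ℂ, ∀ z, P * z ^ 2 + Q * z + R = P * ((z - r) * (z - s)) := by
  obtain ⟨u, hu⟩ := IsAlgClosed.exists_pow_nat_eq (Q ^ 2 - 4 * P * R) (n := 2) (by norm_num)
  refine ⟨(-Q + u) / (2 * P), (-Q - u) / (2 * P), fun z => ?_⟩
  field_simp
  linear_combination (1 : ℂ) * hu

lemma pairSum_ne_zero {b c d : ℂ} (hb : 0 < b.im) (hc : 0 < c.im) (hd : 0 < d.im) :
    pairSum b c d ≠ 0 := by
  have hne : ∀ z : ℂ, 0 < z.im → z ≠ 0 := by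
    rintro z h rfl
    simp at h
  have hinv : ∀ z : ℂ, 0 < z.im → (z⁻¹).im < 0 := by
    intro z h
    rw [Complex.inv_im]
    exact div_neg_of_neg_of_pos (by linarith) (Complex.normSq_pos.2 (hne z h))
  intro h
  have h0 : b⁻¹ + c⁻¹ + d⁻¹ = 0 := by
    have := hne b hb
    have := hne c hc
    have := hne d hd
    field_simp
    unfold pairSum at h
    linear_combination h
  have him := congrArg Complex.im h0
  simp only [Complex.add_im, Complex.zero_im] at him
  linarith [hinv b hb, hinv c hc, hinv d hd]

lemma vamosQuartic_lower_bound_of_ne {a b c d : ℂ} (ha : 0 < a.im) (hb : 0 < b.im)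
    (hc : 0 < c.im) (hd : 0 < d.im) (hbc : b.re / b.im ≠ c.re / c.im)
    (hbd : b.re / b.im ≠ d.re / d.im) (hcd : c.re / c.im ≠ d.re / d.im) :
    ‖pairSum b c d‖ * a.im ^ 2 ≤ ‖vamosQuartic a b c d‖ := by
  have hP := pairSum_ne_zero hb hc hd
  obtain ⟨r, s, hrs⟩ := exists_quadratic_factorization
    (mul_ne_zero (by norm_num : (4 : ℂ) ≠ 0) hP)
    (4 * ((b + c + d) * pairSum b c d + b * c * d))
    (4 * (b + c + d) * (b * c * d) + c ^ 2 * d ^ 2)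
  have hfac : ∀ z, vamosQuartic z b c d = 4 * pairSum b c d * ((z - r) * (z - s)) := by
    intro z
    rw [← hrs]
    unfold vamosQuartic pairSum
    ring
  have him : ∀ z, vamosQuartic z b c d = 0 → a.im ≤ ‖a - z‖ := by
    intro z hz
    have h : z.im ≤ 0 := by
      by_contra hn
      exact vamosQuartic_ne_zero_of_ne (not_le.1 hn) hb hc hd hbc hbd hcd hz
    calc a.im ≤ (a - z).im := by simpa using h
      _ ≤ |(a - z).im| := le_abs_self _
      _ ≤ ‖a - z‖ := Complex.abs_im_le_norm _
  have hr := him r (by rw [hfac]; ring)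
  have hs := him s (by rw [hfac]; ring)
  rw [hfac, norm_mul, norm_mul, norm_mul]
  have h4 : ‖(4 : ℂ)‖ = 4 := by norm_num
  have h5 : a.im ^ 2 ≤ ‖a - r‖ * ‖a - s‖ := by
    rw [sq]
    exact mul_le_mul hr hs ha.le (norm_nonneg _)
  calc ‖pairSum b c d‖ * a.im ^ 2 ≤ ‖pairSum b c d‖ * (‖a - r‖ * ‖a - s‖) :=
        mul_le_mul_of_nonneg_left h5 (norm_nonneg _)
    _ ≤ _ := by
        rw [h4]
        exact mul_le_mul_of_nonneg_right (by linarith [norm_nonneg (pairSum b c d)])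
          (by positivity)

lemma eventually_nhdsNE_affine_ne_zero {K : ℝ} (hK : K ≠ 0) (L : ℝ) :
    ∀ᶠ ε in nhdsWithin (0 : ℝ) {0}ᶜ, L + K * ε ≠ 0 := by
  rcases eq_or_ne L 0 with rfl | hL
  · filter_upwards [self_mem_nhdsWithin] with ε hε
    simpa [hK] using hε
  · have hc : Continuous fun ε : ℝ => L + K * ε := by fun_prop
    exact (hc.continuousAt.eventually_ne (by simpa using hL)).filter_mono nhdsWithin_le_nhds

/-- The quartic is stable. -/
lemma vamosQuartic_ne_zero {a b c d : ℂ} (ha : 0 < a.im) (hb : 0 < b.im) (hc : 0 < c.im)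
    (hd : 0 < d.im) : vamosQuartic a b c d ≠ 0 := by
  have hev : ∀ᶠ ε : ℝ in nhdsWithin (0 : ℝ) {0}ᶜ,
      ‖pairSum b (c + ε) (d - ε)‖ * a.im ^ 2 ≤ ‖vamosQuartic a b (c + ε) (d - ε)‖ := by
    filter_upwards [
      eventually_nhdsNE_affine_ne_zero (neg_ne_zero.2 hb.ne') (b.re * c.im - b.im * c.re),
      eventually_nhdsNE_affine_ne_zero hb.ne' (b.re * d.im - b.im * d.re),
      eventually_nhdsNE_affine_ne_zero (add_pos hc hd).ne' (c.re * d.im - c.im * d.re)]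
      with ε h1 h2 h3
    have hc' : 0 < (c + ε).im := by simpa using hc
    have hd' : 0 < (d - ε).im := by simpa using hd
    refine vamosQuartic_lower_bound_of_ne ha hb hc' hd' ?_ ?_ ?_
    · rw [Ne, div_eq_div_iff hb.ne' hc'.ne']
      contrapose! h1
      simp at h1
      linear_combination h1
    · rw [Ne, div_eq_div_iff hb.ne' hd'.ne']
      contrapose! h2
      simp at h2
      linear_combination h2
    · rw [Ne, div_eq_div_iff hc'.ne' hd'.ne']
      contrapose! h3
      simp at h3
      linear_combination h3
  have hl : Continuous fun ε : ℝ => ‖pairSum b (c + ε) (d - ε)‖ * a.im ^ 2 := by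
    unfold pairSum; fun_prop
  have hr : Continuous fun ε : ℝ => ‖vamosQuartic a b (c + ε) (d - ε)‖ := by
    unfold vamosQuartic; fun_prop
  have hlim := le_of_tendsto_of_tendsto (hl.continuousAt.tendsto.mono_left nhdsWithin_le_nhds)
    (hr.continuousAt.tendsto.mono_left nhdsWithin_le_nhds) hev
  simp only [Complex.ofReal_zero, add_zero, sub_zero] at hlim
  have hpos : 0 < ‖pairSum b c d‖ * a.im ^ 2 :=
    mul_pos (norm_pos_iff.2 (pairSum_ne_zero hb hc hd)) (by positivity)
  exact norm_pos_iff.1 (hpos.trans_le hlim)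

/-- The Grace–Walsh–Szegő coincidence theorem for two variables and the upper half-plane. -/
lemma exists_coincidence {x y A B C : ℂ} (hx : 0 < x.im) (hy : 0 < y.im)
    (h : A + B * (x + y) + C * (x * y) = 0) :
    ∃ z : ℂ, 0 < z.im ∧ A + B * (z + z) + C * (z * z) = 0 := by
  rcases eq_or_ne C 0 with rfl | hC
  · refine ⟨(x + y) / 2, ?_, by linear_combination h⟩
    rw [Complex.div_ofNat_im, Complex.add_im]
    linarith
  obtain ⟨r, s, hrs⟩ := exists_quadratic_factorization hC (2 * B) A
  have hroot : ∀ z, C * ((z - r) * (z - s)) = 0 → A + B * (z + z) + C * (z * z) = 0 := by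
    intro z hz
    linear_combination hrs z + hz
  by_cases hs : 0 < s.im
  · exact ⟨s, hs, hroot s (by ring)⟩
  refine ⟨r, ?_, hroot r (by ring)⟩
  have hA : A = C * (r * s) := by linear_combination hrs 0
  have hB : 2 * B = -C * (r + s) := by linear_combination (hrs 1 - hrs (-1)) / 2
  have hapolar : (x - r) * (y - s) + (x - s) * (y - r) = 0 := by
    have : C * ((x - r) * (y - s) + (x - s) * (y - r)) = 0 := by
      linear_combination 2 * h - 2 * hA - (x + y) * hB
    exact (mul_eq_zero.1 this).resolve_left hC
  have hdisk : ∀ z : ℂ, 0 < z.im → z - s ≠ 0 ∧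
      -s.im * Complex.normSq (z - s)⁻¹ < -((z - s)⁻¹).im := by
    intro z hz
    have hne : z - s ≠ 0 := by
      intro h0
      have := congrArg Complex.im h0
      simp at this
      linarith
    refine ⟨hne, ?_⟩
    have hn := Complex.normSq_pos.2 hne
    rw [Complex.inv_im, Complex.normSq_inv, neg_div, neg_neg, ← div_eq_mul_inv,
      div_lt_div_iff_of_pos_right hn, Complex.sub_im]
    linarith
  obtain ⟨hxs, hx'⟩ := hdisk x hx
  obtain ⟨hys, hy'⟩ := hdisk y hy
  set u := (x - s)⁻¹ with hu
  set v := (y - s)⁻¹ with hv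
  have hprod : (r - s) * ((u + v) / 2) = 1 := by
    rw [hu, hv]
    field_simp
    linear_combination -hapolar
  have hσ : (u + v) / 2 ≠ 0 := right_ne_zero_of_mul_eq_one hprod
  have hrsσ : r - s = ((u + v) / 2)⁻¹ := eq_inv_of_mul_eq_one_left hprod
  have him := congrArg Complex.im hrsσ
  have hn := Complex.normSq_pos.2 hσ
  have hconv : -s.im * Complex.normSq ((u + v) / 2) < -((u + v) / 2).im := by
    have h2 : Complex.normSq ((u + v) / 2) ≤ (Complex.normSq u + Complex.normSq v) / 2 := by
      simp only [Complex.normSq_apply, Complex.div_ofNat_im, Complex.div_ofNat_re,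
        Complex.add_re, Complex.add_im]
      nlinarith [sq_nonneg (u.re - v.re), sq_nonneg (u.im - v.im)]
    have h3 := mul_le_mul_of_nonneg_left h2 (by linarith : 0 ≤ -s.im)
    rw [Complex.div_ofNat_im, Complex.add_im]
    linarith
  rw [Complex.sub_im, Complex.inv_im] at him
  have := (lt_div_iff₀ hn).2 hconv
  linarith

/-- The Vámos polynomial in terms of sums and products over its four pairs of variables. -/
lemma sum_vamosBases_prod (z : Fin 8 → ℂ) :
    ∑ B ∈ vamosBases, ∏ j ∈ B, z j =
      (z 4 * z 5) * (z 6 * z 7) + (z 0 + z 3) * (z 1 + z 2) * (z 4 + z 5) * (z 6 + z 7) +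
      z 0 * z 3 * pairSum (z 1 + z 2) (z 4 + z 5) (z 6 + z 7) +
      z 1 * z 2 * pairSum (z 0 + z 3) (z 4 + z 5) (z 6 + z 7) +
      z 4 * z 5 * pairSum (z 0 + z 3) (z 1 + z 2) (z 6 + z 7) +
      z 6 * z 7 * pairSum (z 0 + z 3) (z 1 + z 2) (z 4 + z 5) := by
  have hsub : ({{0,1,2,3}, {0,3,4,5}, {0,3,6,7}, {1,2,4,5}, {1,2,6,7}} :
      Finset (Finset (Fin 8))) ⊆ Finset.univ.powersetCard 4 := by decide
  have hsd : vamosBases = Finset.univ.powersetCard 4 \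
      ({{0,1,2,3}, {0,3,4,5}, {0,3,6,7}, {1,2,4,5}, {1,2,6,7}} : Finset (Finset (Fin 8))) := by
    ext B
    simp only [vamosBases, Finset.mem_filter, Finset.mem_sdiff]
  have hesymm := Finset.esymm_map_val z Finset.univ 4
  have huniv : (Finset.univ : Finset (Fin 8)).val.map z =
      z 0 ::ₘ z 1 ::ₘ z 2 ::ₘ z 3 ::ₘ z 4 ::ₘ z 5 ::ₘ z 6 ::ₘ z 7 ::ₘ 0 := rfl
  rw [huniv] at hesymm
  rw [hsd, Finset.sum_sdiff_eq_sub hsub, ← hesymm, Finset.sum_insert (by decide),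
    Finset.sum_insert (by decide), Finset.sum_insert (by decide), Finset.sum_insert (by decide),
    Finset.sum_singleton]
  have hfour : ∀ i j k l : Fin 8, i ≠ j → i ≠ k → i ≠ l → j ≠ k → j ≠ l → k ≠ l →
      ∏ m ∈ ({i, j, k, l} : Finset (Fin 8)), z m = z i * z j * z k * z l := by
    intro i j k l h1 h2 h3 h4 h5 h6
    rw [Finset.prod_insert (by simp [h1, h2, h3]), Finset.prod_insert (by simp [h4, h5]),
      Finset.prod_insert (by simp [h6]), Finset.prod_singleton]
    ring
  rw [hfour 0 1 2 3, hfour 0 3 4 5, hfour 0 3 6 7, hfour 1 2 4 5, hfour 1 2 6 7]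
  · simp only [Multiset.esymm, Multiset.powersetCard_cons, Multiset.powersetCard_zero_left,
      Multiset.powersetCard_zero_right, Multiset.map_add, Multiset.map_zero,
      Multiset.map_singleton, Multiset.sum_add, Multiset.sum_zero, Multiset.sum_singleton,
      Multiset.prod_cons, Multiset.prod_zero, pairSum]
    ring
  all_goals decide

/-- The Vámos polynomial is stable. -/
lemma sum_vamosBases_prod_ne_zero {z : Fin 8 → ℂ} (hz : ∀ j, 0 < (z j).im) :
    ∑ B ∈ vamosBases, ∏ j ∈ B, z j ≠ 0 := by
  rw [sum_vamosBases_prod]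
  intro h
  obtain ⟨a, ha, h⟩ := exists_coincidence (hz 0) (hz 3)
    (A := z 4 * z 5 * (z 6 * z 7) + z 1 * z 2 * ((z 4 + z 5) * (z 6 + z 7)) +
      z 4 * z 5 * ((z 1 + z 2) * (z 6 + z 7)) + z 6 * z 7 * ((z 1 + z 2) * (z 4 + z 5)))
    (B := (z 1 + z 2) * (z 4 + z 5) * (z 6 + z 7) + z 1 * z 2 * (z 4 + z 5 + (z 6 + z 7)) +
      z 4 * z 5 * (z 1 + z 2 + (z 6 + z 7)) + z 6 * z 7 * (z 1 + z 2 + (z 4 + z 5)))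
    (C := pairSum (z 1 + z 2) (z 4 + z 5) (z 6 + z 7))
    (by unfold pairSum at *; linear_combination h)
  obtain ⟨b, hb, h⟩ := exists_coincidence (hz 1) (hz 2)
    (A := z 4 * z 5 * (z 6 * z 7) + a * a * ((z 4 + z 5) * (z 6 + z 7)) +
      z 4 * z 5 * ((a + a) * (z 6 + z 7)) + z 6 * z 7 * ((a + a) * (z 4 + z 5)))
    (B := (a + a) * (z 4 + z 5) * (z 6 + z 7) + a * a * (z 4 + z 5 + (z 6 + z 7)) +
      z 4 * z 5 * (a + a + (z 6 + z 7)) + z 6 * z 7 * (a + a + (z 4 + z 5)))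
    (C := pairSum (a + a) (z 4 + z 5) (z 6 + z 7))
    (by unfold pairSum at *; linear_combination h)
  obtain ⟨c, hc, h⟩ := exists_coincidence (hz 4) (hz 5)
    (A := a * a * ((b + b) * (z 6 + z 7)) + b * b * ((a + a) * (z 6 + z 7)) +
      z 6 * z 7 * ((a + a) * (b + b)))
    (B := (a + a) * (b + b) * (z 6 + z 7) + a * a * (b + b + (z 6 + z 7)) +
      b * b * (a + a + (z 6 + z 7)) + z 6 * z 7 * (a + a + (b + b)))
    (C := z 6 * z 7 + pairSum (a + a) (b + b) (z 6 + z 7))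
    (by unfold pairSum at *; linear_combination h)
  obtain ⟨d, hd, h⟩ := exists_coincidence (hz 6) (hz 7)
    (A := a * a * ((b + b) * (c + c)) + b * b * ((a + a) * (c + c)) + c * c * ((a + a) * (b + b)))
    (B := (a + a) * (b + b) * (c + c) + a * a * (b + b + (c + c)) + b * b * (a + a + (c + c)) +
      c * c * (a + a + (b + b)))
    (C := c * c + pairSum (a + a) (b + b) (c + c))
    (by unfold pairSum at *; linear_combination h)
  refine vamosQuartic_ne_zero ha hb hc hd ?_
  unfold pairSum at h
  unfold vamosQuartic
  linear_combination h

lemma vamosBases_card {B : Finset (Fin 8)} (hB : B ∈ vamosBases) : B.card = 4 :=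
  (Finset.mem_powersetCard.1 (Finset.mem_filter.1 hB).1).2

theorem stmt11 :
    IsRealZeroPoly (MvPolynomial.aeval (fun i => MvPolynomial.X i + 1) vamosPoly) := by
  intro x μ h
  have hsum : ∑ B ∈ vamosBases, ∏ j ∈ B, (μ * (x j : ℂ) + 1) = 0 := by
    simpa [vamosPoly, map_sum, map_prod] using h
  by_contra hμ
  have hμ0 : μ ≠ 0 := by
    rintro rfl
    simp at hμ
  have hscale : ∀ l : ℂ, ∑ B ∈ vamosBases, ∏ j ∈ B, l * (μ * (x j : ℂ) + 1) = 0 := by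
    intro l
    have : ∀ B ∈ vamosBases, ∏ j ∈ B, l * (μ * (x j : ℂ) + 1) =
        l ^ 4 * ∏ j ∈ B, (μ * (x j : ℂ) + 1) := by
      intro B hB
      rw [Finset.prod_mul_distrib, Finset.prod_const, vamosBases_card hB]
    rw [Finset.sum_congr rfl this, ← Finset.mul_sum, hsum, mul_zero]
  have him : ∀ (l : ℝ) (j : Fin 8),
      ((l * μ⁻¹ : ℂ) * (μ * (x j : ℂ) + 1)).im = -(l * μ.im) / Complex.normSq μ := by
    intro l j
    have : (l * μ⁻¹ : ℂ) * (μ * (x j : ℂ) + 1) = ((l * x j : ℝ) : ℂ) + l * μ⁻¹ := by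
      push_cast
      field_simp
    rw [this, Complex.add_im, Complex.ofReal_im, Complex.im_ofReal_mul, Complex.inv_im]
    ring
  refine sum_vamosBases_prod_ne_zero (fun j => ?_) (hscale (((-μ.im : ℝ) : ℂ) * μ⁻¹))
  rw [him, neg_mul, neg_neg]
  exact div_pos (mul_self_pos.2 hμ) (Complex.normSq_pos.2 hμ0)
end

section
/- Suppose h ∈ ℝ[x₁,…,xₙ] is a homogeneous polynomial hyperbolic with respect to e ∈ ℝⁿ, the vectors e₁,…,e_m lie in the closure of the hyperbolicity cone of h containing e, and e₀ ∈ ℝⁿ is arbitrary. Then the polynomial p(x₁,…,x_m) = h(e₀ + x₁e₁ + ⋯ + x_m e_m) is either stable or identically zero. -/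
open Complex Metric

/-- A form of Hurwitz' theorem for families of entire functions. -/
lemma hurwitz_ne_zero {X : Type*} [TopologicalSpace X] {F : X → ℂ → ℂ}
    (hF : Continuous fun q : X × ℂ => F q.1 q.2) (hd : ∀ x, Differentiable ℂ (F x))
    {x₀ : X} {U : Set ℂ} (hU : IsOpen U) (hx₀ : x₀ ∈ closure {x | ∀ z ∈ U, F x z ≠ 0})
    (hne : ∃ z, F x₀ z ≠ 0) {c : ℂ} (hc : c ∈ U) : F x₀ c ≠ 0 := by
  obtain ⟨z₁, hz₁⟩ := hne
  have han : AnalyticOnNhd ℂ (F x₀) Set.univ := fun z _ => (hd x₀).analyticAt z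
  have hev : ∀ᶠ z in nhdsWithin c {c}ᶜ, F x₀ z ≠ 0 := by
    rcases (han c trivial).eventually_eq_zero_or_eventually_ne_zero with h0 | h0
    · exact absurd (han.eqOn_zero_of_preconnected_of_eventuallyEq_zero isPreconnected_univ
        trivial h0 (Set.mem_univ z₁)) hz₁
    · exact h0
  rw [eventually_nhdsWithin_iff, Metric.eventually_nhds_iff] at hev
  obtain ⟨r₁, hr₁, hr₁'⟩ := hev
  obtain ⟨r₂, hr₂, hr₂'⟩ := Metric.isOpen_iff.1 hU c hc
  obtain ⟨r, hr, hrr⟩ := exists_between (lt_min hr₁ hr₂)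
  have hsph : ∀ z ∈ sphere c r, F x₀ z ≠ 0 := fun z hz => by
    have hz' : dist z c = r := hz
    refine hr₁' (by rw [hz']; exact hrr.trans_le (min_le_left _ _)) ?_
    rintro rfl
    rw [dist_self] at hz'
    exact hr.ne hz'
  have hball : closedBall c r ⊆ U := fun z hz =>
    hr₂' (lt_of_le_of_lt hz (hrr.trans_le (min_le_right _ _)))
  have hcont : Continuous (F x₀) := (hd x₀).continuous
  obtain ⟨w, hw, hmin⟩ := (isCompact_sphere c r).exists_isMinOn
    (NormedSpace.sphere_nonempty.2 hr.le) hcont.norm.continuousOn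
  set δ := ‖F x₀ w‖ / 2 with hδ
  have hwpos : 0 < ‖F x₀ w‖ := norm_pos_iff.2 (hsph w hw)
  have hopen : IsOpen {q : X × ℂ | δ < ‖F q.1 q.2‖} := isOpen_lt continuous_const hF.norm
  obtain ⟨A, B, hA, -, hxA, hB, hAB⟩ := generalized_tube_lemma (s := {x₀}) isCompact_singleton
    (t := sphere c r) (isCompact_sphere c r) hopen (by
      rintro ⟨x, z⟩ ⟨hx, hz⟩
      obtain rfl : x = x₀ := hx
      have := hmin hz
      simp only [Set.mem_ofPred_eq] at this ⊢
      linarith)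
  have key : ∀ x ∈ A ∩ {x | ∀ z ∈ U, F x z ≠ 0}, δ ≤ ‖F x c‖ := by
    rintro x ⟨hxA', hxU⟩
    have hne' : ∀ z ∈ closedBall c r, F x z ≠ 0 := fun z hz => hxU z (hball hz)
    have hdc : DiffContOnCl ℂ (fun z => (F x z)⁻¹) (ball c r) := by
      refine DifferentiableOn.diffContOnCl ?_
      rw [closure_ball c hr.ne']
      exact (hd x).differentiableOn.inv hne'
    have := Complex.norm_le_of_forall_mem_frontier_norm_le isBounded_ball hdc (C := δ⁻¹)
      (by
        intro z hz
        rw [frontier_ball c hr.ne'] at hz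
        have : δ < ‖F x z‖ := hAB (Set.mk_mem_prod hxA' (hB hz))
        rw [norm_inv]
        exact inv_anti₀ (by positivity) this.le)
      (subset_closure (mem_ball_self hr))
    rw [norm_inv] at this
    exact (inv_le_inv₀ (norm_pos_iff.2 (hxU c hc)) (by positivity)).1 this
  have hmem : x₀ ∈ closure (A ∩ {x | ∀ z ∈ U, F x z ≠ 0}) :=
    hA.inter_closure ⟨hxA rfl, hx₀⟩
  have hclosed : IsClosed {x | δ ≤ ‖F x c‖} :=
    isClosed_le continuous_const (hF.comp (by fun_prop : Continuous fun x => (x, c))).norm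
  have : δ ≤ ‖F x₀ c‖ := closure_minimal key hclosed hmem
  exact norm_pos_iff.1 (lt_of_lt_of_le (by positivity) this)

/-- If a connected family of entire functions has no zeros on the unit circle, and one member has
no zeros in the closed unit disc, then no member has zeros in the closed unit disc. -/
lemma ne_zero_on_closedBall_of_preconnected {X : Type*} [TopologicalSpace X] [PreconnectedSpace X]
    {F : X → ℂ → ℂ} (hF : Continuous fun q : X × ℂ => F q.1 q.2)
    (hd : ∀ x, Differentiable ℂ (F x)) (hsph : ∀ x, ∀ z ∈ sphere (0 : ℂ) 1, F x z ≠ 0)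
    {x₀ : X} (hx₀ : ∀ z ∈ closedBall (0 : ℂ) 1, F x₀ z ≠ 0) (x : X) :
    ∀ z ∈ closedBall (0 : ℂ) 1, F x z ≠ 0 := by
  set S : Set X := {x | ∀ z ∈ closedBall (0 : ℂ) 1, F x z ≠ 0} with hS
  have hopen : IsOpen S := by
    rw [isOpen_iff_forall_mem_open]
    intro y hy
    obtain ⟨A, B, hA, -, hyA, hB, hAB⟩ := generalized_tube_lemma (s := {y}) isCompact_singleton
      (t := closedBall (0 : ℂ) 1) (isCompact_closedBall 0 1)
      (isOpen_ne_fun hF continuous_const : IsOpen {q : X × ℂ | F q.1 q.2 ≠ 0}) (by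
        rintro ⟨x, z⟩ ⟨hx, hz⟩
        obtain rfl : x = y := hx
        exact hy z hz)
    exact ⟨A, fun x hx z hz => hAB (Set.mk_mem_prod hx (hB hz)), hA, hyA rfl⟩
  have hclosed : IsClosed S := by
    refine isClosed_of_closure_subset fun y hy z hz => ?_
    rcases eq_or_lt_of_le (mem_closedBall.1 hz) with h1 | h1
    · exact hsph y z h1
    · refine hurwitz_ne_zero hF hd (U := ball 0 1) isOpen_ball
        (closure_mono (fun x (hx : x ∈ S) z hz => hx z (ball_subset_closedBall hz)) hy)
        ⟨1, hsph y 1 (by simp)⟩ h1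
  have := IsClopen.eq_univ ⟨hclosed, hopen⟩ ⟨x₀, hx₀⟩
  exact (this.symm ▸ Set.mem_univ x : x ∈ S)

lemma MvPolynomial.differentiable_aeval {n : ℕ} (h : MvPolynomial (Fin n) ℝ) :
    Differentiable ℂ fun v : Fin n → ℂ => MvPolynomial.aeval v h := by
  induction h using MvPolynomial.induction_on with
  | C a => simp only [MvPolynomial.aeval_C]; exact differentiable_const _
  | add p q hp hq => simp only [map_add]; exact hp.add hq
  | mul_X p i hp => simp only [map_mul, MvPolynomial.aeval_X]; exact hp.mul (differentiable_apply i)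

lemma MvPolynomial.IsHomogeneous.aeval_mul {n d : ℕ} {h : MvPolynomial (Fin n) ℝ}
    (hhom : h.IsHomogeneous d) (c : ℂ) (v : Fin n → ℂ) :
    MvPolynomial.aeval (fun i => c * v i) h = c ^ d * MvPolynomial.aeval v h := by
  simp only [MvPolynomial.aeval_def, MvPolynomial.eval₂_eq, Finset.mul_sum]
  refine Finset.sum_congr rfl fun s hs => ?_
  have : ∑ i ∈ s.support, s i = d := by
    have := hhom (MvPolynomial.mem_support_iff.1 hs)
    simpa [Finsupp.weight_apply, Finsupp.sum] using this
  simp only [mul_pow, Finset.prod_mul_distrib, Finset.prod_pow_eq_pow_sum, this]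
  ring

/-- The closed analogue of `hypCone`: no zeros of `μ ↦ h(x + μe)` have positive real part. -/
def closedHypCone {n : ℕ} (h : MvPolynomial (Fin n) ℝ) (e : Fin n → ℝ) : Set (Fin n → ℝ) :=
  {x | ∀ μ : ℂ, 0 < μ.re → MvPolynomial.aeval (fun i => (x i : ℂ) + μ * (e i : ℂ)) h ≠ 0}

/-- Those `w` for which `h(a + i(w + se)) ≠ 0` for all real `a` and `s > 0`. -/
def nonvanishingCone {n : ℕ} (h : MvPolynomial (Fin n) ℝ) (e : Fin n → ℝ) : Set (Fin n → ℝ) :=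
  {w | ∀ (a : Fin n → ℝ) (s : ℝ), 0 < s →
    MvPolynomial.aeval (fun i => (a i : ℂ) + I * ((w i : ℂ) + s * (e i : ℂ))) h ≠ 0}

section

variable {n d : ℕ} {h : MvPolynomial (Fin n) ℝ} {e : Fin n → ℝ}

lemma closure_hypCone_subset (hhyp : IsHyperbolicWrt h e) :
    closure (hypCone h e) ⊆ closedHypCone h e := by
  intro b hb μ hμ
  have hcont := (MvPolynomial.differentiable_aeval h).continuous
  refine hurwitz_ne_zero
    (F := fun (b : Fin n → ℝ) μ => MvPolynomial.aeval (fun i => (b i : ℂ) + μ * (e i : ℂ)) h)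
    (U := {z | 0 < z.re}) ?_ ?_ ?_ ?_ ?_ hμ
  · exact hcont.comp (by fun_prop)
  · exact fun x => (MvPolynomial.differentiable_aeval h).comp (by fun_prop)
  · exact isOpen_lt continuous_const continuous_re
  · refine closure_mono (fun x hx z hz h0 => ?_) hb
    obtain ⟨r, rfl, hr⟩ := hx z h0
    simp only [Set.mem_ofPred_eq, ofReal_re] at hz
    linarith
  · exact ⟨I, fun h0 => by simpa using hhyp.2 b I h0⟩

lemma smul_mem_closedHypCone (hhom : h.IsHomogeneous d) {b : Fin n → ℝ}
    (hb : b ∈ closedHypCone h e) {t : ℝ} (ht : 0 < t) : t • b ∈ closedHypCone h e := by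
  intro μ hμ
  have ht' : (t : ℂ) ≠ 0 := ofReal_ne_zero.2 ht.ne'
  have hre : 0 < (μ / t).re := by rw [div_ofReal_re]; positivity
  have := mul_ne_zero (pow_ne_zero d ht') (hb _ hre)
  rw [← hhom.aeval_mul] at this
  convert this using 2
  refine congrArg MvPolynomial.aeval (funext fun i => ?_)
  simp only [Pi.smul_apply, smul_eq_mul, ofReal_mul]
  field_simp

lemma zero_mem_nonvanishingCone (hhyp : IsHyperbolicWrt h e) : 0 ∈ nonvanishingCone h e := by
  intro a s hs h0
  have := hhyp.2 a (I * s) (by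
    rw [← h0]
    congr 2 with i
    simp [mul_assoc])
  simp at this
  exact hs.ne' this

lemma smul_mem_nonvanishingCone (hhom : h.IsHomogeneous d) (hhyp : IsHyperbolicWrt h e)
    {w : Fin n → ℝ} (hw : w ∈ nonvanishingCone h e) {t : ℝ} (ht : 0 ≤ t) :
    t • w ∈ nonvanishingCone h e := by
  rcases ht.eq_or_lt with rfl | ht
  · simpa using zero_mem_nonvanishingCone hhyp
  intro a s hs
  have ht' : (t : ℂ) ≠ 0 := ofReal_ne_zero.2 ht.ne'
  have := mul_ne_zero (pow_ne_zero d ht') (hw (t⁻¹ • a) (s / t) (by positivity))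
  rw [← hhom.aeval_mul] at this
  convert this using 2
  refine congrArg MvPolynomial.aeval (funext fun i => ?_)
  simp only [Pi.smul_apply, smul_eq_mul, ofReal_mul, ofReal_div, ofReal_inv]
  field_simp

/-- Points of the unit circle other than `1` are mapped to the real line. -/
lemma exists_real_cayley {z : ℂ} (hz : ‖z‖ = 1) (h1 : z ≠ 1) :
    ∃ t : ℝ, I * (1 + z) = (1 - z) * t := by
  have hne : 1 - z ≠ 0 := sub_ne_zero.2 (Ne.symm h1)
  have hsq : z.re * z.re + z.im * z.im = 1 := by
    rw [← normSq_apply, normSq_eq_norm_sq, hz, one_pow]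
  have him : (I * (1 + z) / (1 - z)).im = 0 := by
    rw [div_im]
    simp only [mul_re, mul_im, I_re, I_im, add_re, add_im, sub_re, sub_im, one_re, one_im]
    rw [← sub_div]
    refine div_eq_zero_iff.2 (Or.inl ?_)
    linear_combination -hsq
  refine ⟨(I * (1 + z) / (1 - z)).re, ?_⟩
  rw [← (Complex.ext rfl (by simp [him]) :
    I * (1 + z) / (1 - z) = ((I * (1 + z) / (1 - z)).re : ℂ))]
  field_simp

lemma cayley_re_nonneg {z : ℂ} (hz : ‖z‖ ≤ 1) : 0 ≤ ((1 - z) / (1 + z)).re := by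
  have hsq : z.re * z.re + z.im * z.im ≤ 1 := by
    rw [← normSq_apply, normSq_eq_norm_sq]
    exact pow_le_one₀ (norm_nonneg z) hz
  rw [div_re, ← add_div]
  refine div_nonneg ?_ (normSq_nonneg _)
  simp only [add_re, add_im, sub_re, sub_im, one_re, one_im]
  linarith

lemma add_mem_nonvanishingCone (hhom : h.IsHomogeneous d) (hhyp : IsHyperbolicWrt h e)
    {w b : Fin n → ℝ} (hw : w ∈ nonvanishingCone h e) (hb : b ∈ closedHypCone h e) :
    w + b ∈ nonvanishingCone h e := by
  intro a s₀ hs₀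
  obtain ⟨s, rfl⟩ : ∃ s, s₀ = s + s := ⟨s₀ / 2, by ring⟩
  have hs : 0 < s := by linarith
  have hcont := (MvPolynomial.differentiable_aeval h).continuous
  have hmain := ne_zero_on_closedBall_of_preconnected (X := unitInterval)
    (F := fun l z => MvPolynomial.aeval (fun i =>
      (1 - z) * (((l : ℝ) : ℂ) * ((a i : ℂ) + I * (w i : ℂ)) + I * (s * (e i : ℂ))) +
        I * (1 + z) * ((b i : ℂ) + s * (e i : ℂ))) h)
    (hcont.comp (by fun_prop))
    (fun x => (MvPolynomial.differentiable_aeval h).comp (by fun_prop))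
    (x₀ := 0) ?_ ?_ 1 0 (by simp)
  · convert hmain using 2
    refine congrArg MvPolynomial.aeval (funext fun i => ?_)
    simp
    ring
  · intro l z hz
    rw [mem_sphere_zero_iff_norm] at hz
    by_cases h1 : z = 1
    · subst h1
      have := mul_ne_zero (pow_ne_zero d (mul_ne_zero two_ne_zero I_ne_zero)) (hb s (by simpa))
      rw [← hhom.aeval_mul] at this
      convert this using 2
      refine congrArg MvPolynomial.aeval (funext fun i => ?_)
      ring
    · obtain ⟨t, ht⟩ := exists_real_cayley hz h1
      have := mul_ne_zero (pow_ne_zero d (sub_ne_zero.2 (Ne.symm h1)))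
        (smul_mem_nonvanishingCone hhom hhyp hw l.2.1
          ((l : ℝ) • a + t • (b + s • e)) s hs)
      rw [← hhom.aeval_mul] at this
      convert this using 2
      refine congrArg MvPolynomial.aeval (funext fun i => ?_)
      rw [ht]
      simp
      ring
  · intro z hz
    rw [mem_closedBall_zero_iff] at hz
    by_cases h1 : 1 + z = 0
    · obtain rfl : z = -1 := by linear_combination h1
      have he : MvPolynomial.aeval (fun i => (e i : ℂ)) h ≠ 0 := by
        have := MvPolynomial.aeval_algebraMap_apply ℂ e h
        change MvPolynomial.aeval (fun i => (e i : ℂ)) h = _ at this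
        rw [this, MvPolynomial.aeval_eq_eval]
        simpa using hhyp.1
      have := mul_ne_zero (pow_ne_zero d (mul_ne_zero two_ne_zero
        (mul_ne_zero I_ne_zero (ofReal_ne_zero.2 hs.ne')))) he
      rw [← hhom.aeval_mul] at this
      convert this using 2
      refine congrArg MvPolynomial.aeval (funext fun i => ?_)
      simp
      ring
    · have hre : 0 < ((s : ℂ) * ((1 - z) / (1 + z)) + s).re := by
        rw [add_re, re_ofReal_mul, ofReal_re]
        have := mul_nonneg hs.le (cayley_re_nonneg hz)
        linarith
      have := mul_ne_zero (pow_ne_zero d (mul_ne_zero I_ne_zero h1)) (hb _ hre)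
      rw [← hhom.aeval_mul] at this
      convert this using 2
      refine congrArg MvPolynomial.aeval (funext fun i => ?_)
      simp
      field_simp
      ring

lemma sum_smul_mem_nonvanishingCone (hhom : h.IsHomogeneous d) (hhyp : IsHyperbolicWrt h e)
    {ι : Type*} (S : Finset ι) (E : ι → Fin n → ℝ) (hE : ∀ i, E i ∈ closedHypCone h e)
    (t : ι → ℝ) (ht : ∀ i, 0 < t i) : ∑ i ∈ S, t i • E i ∈ nonvanishingCone h e := by
  classical
  induction S using Finset.induction_on with
  | empty => simpa using zero_mem_nonvanishingCone hhyp
  | insert i S hi ih =>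
    rw [Finset.sum_insert hi, add_comm]
    exact add_mem_nonvanishingCone hhom hhyp ih (smul_mem_closedHypCone hhom (hE i) (ht i))

end

theorem stmt15 (n m d : ℕ) (h : MvPolynomial (Fin n) ℝ) (e : Fin n → ℝ)
    (hhom : h.IsHomogeneous d) (hhyp : IsHyperbolicWrt h e)
    (e₀ : Fin n → ℝ) (E : Fin m → (Fin n → ℝ)) (hE : ∀ i, E i ∈ closure (hypCone h e)) :
    let p : MvPolynomial (Fin m) ℝ := MvPolynomial.aeval
      (fun j => MvPolynomial.C (e₀ j) + ∑ i, MvPolynomial.C (E i j) * MvPolynomial.X i) h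
    (∀ x : Fin m → ℂ, (∀ j, 0 < (x j).im) → MvPolynomial.aeval x p ≠ 0) ∨ p = 0 := by
  intro p
  have hp : ∀ x : Fin m → ℂ, MvPolynomial.aeval x p =
      MvPolynomial.aeval (fun j => (e₀ j : ℂ) + ∑ i, (E i j : ℂ) * x i) h := by
    intro x
    rw [← AlgHom.comp_apply, MvPolynomial.comp_aeval]
    simp
  rw [or_iff_not_imp_left]
  intro hx
  push Not at hx
  obtain ⟨x₀, hx₀, hzero⟩ := hx
  have hK : ∀ i, E i ∈ closedHypCone h e := fun i => closure_hypCone_subset hhyp (hE i)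
  have hcont := (MvPolynomial.differentiable_aeval h).continuous
  have hall : ∀ x : Fin m → ℂ, MvPolynomial.aeval x p = 0 := by
    intro x
    by_contra hx
    refine hurwitz_ne_zero (F := fun (s : ℝ) z => MvPolynomial.aeval (fun j => (e₀ j : ℂ) +
        ∑ i, (E i j : ℂ) * (x₀ i + z * (x i - x₀ i)) + I * (s * (e j : ℂ))) h)
      (U := {z | ∀ i, 0 < (x₀ i + z * (x i - x₀ i)).im}) (x₀ := 0) (c := 0)
      (hcont.comp (by fun_prop))
      (fun x => (MvPolynomial.differentiable_aeval h).comp (by fun_prop)) ?_ ?_ ⟨1, ?_⟩ ?_ ?_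
    · simp only [Set.ofPred_forall]
      exact isOpen_iInter_of_finite fun i => isOpen_lt continuous_const (by fun_prop)
    · have h0 : (0 : ℝ) ∈ closure (Set.Ioi 0) := by simp
      refine closure_mono (fun s hs z hz => ?_) h0
      have := sum_smul_mem_nonvanishingCone hhom hhyp Finset.univ E hK _ hz
        (e₀ + ∑ i, (x₀ i + z * (x i - x₀ i)).re • E i) s hs
      convert this using 2
      refine congrArg MvPolynomial.aeval (funext fun j => ?_)
      simp only [Pi.add_apply, Finset.sum_apply, Pi.smul_apply, smul_eq_mul, ofReal_add,
        ofReal_sum, ofReal_mul, mul_add, Finset.mul_sum]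
      rw [add_assoc, add_assoc, ← add_assoc (∑ _, _) (∑ _, _), ← Finset.sum_add_distrib]
      congr 2
      refine Finset.sum_congr rfl fun i _ => ?_
      rw [← mul_add]
      conv_lhs => rw [← re_add_im (x₀ i + z * (x i - x₀ i))]
      ring
    · rw [hp] at hx
      simpa using hx
    · simpa using hx₀
    · rw [hp] at hzero
      simpa using hzero
  refine MvPolynomial.funext fun x => ?_
  have h1 := MvPolynomial.aeval_algebraMap_apply ℂ x p
  have h2 := hall fun i => (x i : ℂ)
  change MvPolynomial.aeval (fun i => (x i : ℂ)) p = _ at h1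
  rw [h1, MvPolynomial.aeval_eq_eval] at h2
  simpa using h2
end
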